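/- Let K be a field and G a connected finite simple graph on [n] such that the quotient ring S/J_G of the binomial edge ideal is Gorenstein. Then G is a path graph. -/

import Mathlib

open MvPolynomial

noncomputable section

/-- The binomial edge ideal of a simple graph `G` on vertex set `V`, inside
`K[x_v, y_v : v ∈ V] = MvPolynomial (V ⊕ V) K`. -/
def binomialEdgeIdeal (K : Type) [Field K] {V : Type} (G : SimpleGraph V) :
    Ideal (MvPolynomial (V ⊕ V) K) :=
  Ideal.span {f | ∃ i j, G.Adj i j ∧
    f = X (Sum.inl i) * X (Sum.inr j) - X (Sum.inl j) * X (Sum.inr i)}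

/-- A minimal graded free resolution of the quotient `S/I`. -/
structure MinimalGradedFreeResolutionOfQuotient {σ K : Type} [Field K]
    (I : Ideal (MvPolynomial σ K)) where
  rank : ℕ → ℕ
  twist : (i : ℕ) → Fin (rank i) → ℕ
  gen : Fin (rank 0) → MvPolynomial σ K
  diff : (i : ℕ) → Matrix (Fin (rank i)) (Fin (rank (i + 1))) (MvPolynomial σ K)
  gen_homog : ∀ e, (gen e).IsHomogeneous (twist 0 e)
  gen_span : ∀ g : MvPolynomial σ K,
    ∃ c : Fin (rank 0) → MvPolynomial σ K, g - ∑ e, c e * gen e ∈ I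
  diff_homog : ∀ i r c, diff i r c = 0 ∨
    (twist i r ≤ twist (i + 1) c ∧
      (diff i r c).IsHomogeneous (twist (i + 1) c - twist i r))
  minimal : ∀ i r c, constantCoeff (diff i r c) = 0
  exact_zero : ∀ v : Fin (rank 0) → MvPolynomial σ K,
    (∑ e, v e * gen e ∈ I) ↔ ∃ w, v = (diff 0).mulVec w
  exact_succ : ∀ i (v : Fin (rank (i + 1)) → MvPolynomial σ K),
    (diff i).mulVec v = 0 ↔ ∃ w, v = (diff (i + 1)).mulVec w
  fin_length : ∃ N, ∀ i, N ≤ i → rank i = 0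

/-- The projective dimension read off from a minimal graded free resolution:
the largest homological degree in which the resolution is nonzero. -/
def MinimalGradedFreeResolutionOfQuotient.projDim {σ K : Type} [Field K]
    {I : Ideal (MvPolynomial σ K)}
    (F : MinimalGradedFreeResolutionOfQuotient I) : ℕ :=
  sSup {i : ℕ | F.rank i ≠ 0}

/-- The depth (with respect to the graded maximal ideal) of the quotient `S/I`
of a polynomial ring `S = MvPolynomial σ K`, as an `S`-module. -/
def quotientDepth {σ K : Type} [Field K] (I : Ideal (MvPolynomial σ K)) : ℕ :=
  sSup {d : ℕ | ∃ rs : List (MvPolynomial σ K), rs.length = d ∧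
    (∀ r ∈ rs, constantCoeff r = 0) ∧
    RingTheory.Sequence.IsRegular (MvPolynomial σ K ⧸ I) rs}

/-- `S/I` is Gorenstein iff it is Cohen–Macaulay (depth = Krull dimension) of
Cohen–Macaulay type one, i.e. the last total Betti number in the minimal
graded free resolution of `S/I` equals `1`. -/
def QuotientIsGorenstein {σ K : Type} [Field K]
    (I : Ideal (MvPolynomial σ K)) : Prop :=
  (quotientDepth I : WithBot (WithTop ℕ)) = ringKrullDim (MvPolynomial σ K ⧸ I) ∧
    ∀ F : MinimalGradedFreeResolutionOfQuotient I, F.rank F.projDim = 1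


noncomputable section

section Graded
variable {σ K Λ : Type} [Field K] [AddCommGroup Λ] (w : σ → Λ)

lemma whc_mul {a : Λ} {f : MvPolynomial σ K} (hf : IsWeightedHomogeneous w f a) (n : Λ)
    (g : MvPolynomial σ K) :
    weightedHomogeneousComponent w n (f * g) = f * weightedHomogeneousComponent w (n - a) g := by
  induction g using MvPolynomial.induction_on' with
  | monomial d r =>
    have h := isWeightedHomogeneous_monomial w d r rfl
    have h2 := hf.mul h
    by_cases hn : n - a = Finsupp.weight w d
    · have : n = a + Finsupp.weight w d := by rw [← hn]; simp
      rw [hn, h.weightedHomogeneousComponent_same, this, h2.weightedHomogeneousComponent_same]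
    · rw [h.weightedHomogeneousComponent_ne _ hn, mul_zero,
        h2.weightedHomogeneousComponent_ne]
      intro h3
      exact hn (by rw [h3]; simp)
  | add p q hp hq => rw [mul_add, map_add, map_add, mul_add, hp, hq]

variable {ι κ : Type}

def vcomp (τ : ι → Λ) (c : Λ) (v : ι → MvPolynomial σ K) : ι → MvPolynomial σ K :=
  fun e => weightedHomogeneousComponent w (c - τ e) (v e)

def VHom (τ : ι → Λ) (c : Λ) (v : ι → MvPolynomial σ K) : Prop :=
  ∀ e, IsWeightedHomogeneous w (v e) (c - τ e)

lemma vcomp_hom (τ : ι → Λ) (c : Λ) (v : ι → MvPolynomial σ K) : VHom w τ c (vcomp w τ c v) :=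
  fun _ => weightedHomogeneousComponent_isWeightedHomogeneous _ _

lemma vcomp_same {τ : ι → Λ} {c : Λ} {v : ι → MvPolynomial σ K} (h : VHom w τ c v) :
    vcomp w τ c v = v := by
  funext e; exact (h e).weightedHomogeneousComponent_same

lemma vcomp_mulVec [Fintype κ] {τ : ι → Λ} {τ' : κ → Λ} (A : Matrix ι κ (MvPolynomial σ K))
    (hA : ∀ r e, IsWeightedHomogeneous w (A r e) (τ' e - τ r)) (c : Λ)
    (v : κ → MvPolynomial σ K) :
    vcomp w τ c (A.mulVec v) = A.mulVec (vcomp w τ' c v) := by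
  funext r
  simp only [vcomp, Matrix.mulVec, dotProduct, map_sum]
  refine Finset.sum_congr rfl fun e _ => ?_
  rw [whc_mul w (hA r e), sub_sub_sub_cancel_right]

lemma mulVec_hom [Fintype κ] {τ : ι → Λ} {τ' : κ → Λ} (A : Matrix ι κ (MvPolynomial σ K))
    (hA : ∀ r e, IsWeightedHomogeneous w (A r e) (τ' e - τ r)) {c : Λ}
    {v : κ → MvPolynomial σ K} (hv : VHom w τ' c v) : VHom w τ c (A.mulVec v) := by
  rw [← vcomp_same w hv, ← vcomp_mulVec w A hA]
  exact vcomp_hom w _ _ _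

lemma exists_vsum [Fintype ι] (τ : ι → Λ) (v : ι → MvPolynomial σ K) :
    ∃ s : Finset Λ, v = ∑ c ∈ s, vcomp w τ c v := by
  classical
  refine ⟨Finset.univ.biUnion fun e => (v e).support.image fun m => τ e + Finsupp.weight w m, ?_⟩
  funext e
  ext m
  rw [Finset.sum_apply, coeff_sum]
  simp only [vcomp, coeff_weightedHomogeneousComponent]
  by_cases h : coeff m (v e) = 0
  · simp [h]
  · rw [Finset.sum_eq_single (τ e + Finsupp.weight w m)]
    · simp
    · intro b _ hb
      rw [if_neg]
      intro h2
      exact hb (by rw [h2]; simp)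
    · intro h2
      exfalso; apply h2
      simp only [Finset.mem_biUnion, Finset.mem_univ, true_and, Finset.mem_image]
      exact ⟨e, m, by simpa using h, rfl⟩

lemma exists_min_gens [Finite σ] [Fintype ι] (hpos : ∀ m : σ →₀ ℕ, Finsupp.weight w m = 0 → m = 0)
    (τ : ι → Λ) (N : Submodule (MvPolynomial σ K) (ι → MvPolynomial σ K))
    (hN : ∀ v ∈ N, ∀ c, vcomp w τ c v ∈ N) :
    ∃ (k : ℕ) (A : Matrix ι (Fin k) (MvPolynomial σ K)) (τ' : Fin k → Λ),
      (∀ r e, IsWeightedHomogeneous w (A r e) (τ' e - τ r)) ∧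
      (∀ v, v ∈ N ↔ ∃ a, v = A.mulVec a) ∧
      (∀ a, A.mulVec a = 0 → ∀ j, constantCoeff (a j) = 0) := by
  classical
  let P : ℕ → Prop := fun k => ∃ (G : Fin k → (ι → MvPolynomial σ K)) (τ' : Fin k → Λ),
      (∀ j, VHom w τ (τ' j) (G j)) ∧ Submodule.span (MvPolynomial σ K) (Set.range G) = N
  have hP : ∃ k, P k := by
    obtain ⟨T, hT⟩ : N.FG := IsNoetherian.noetherian N
    choose s hs using exists_vsum (K := K) w τ
    let T' : Finset (Λ × (ι → MvPolynomial σ K)) :=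
      T.biUnion fun v => (s v).image fun c => (c, vcomp w τ c v)
    let f := T'.equivFin.symm
    refine ⟨T'.card, fun j => (f j).1.2, fun j => (f j).1.1, ?_, ?_⟩
    · intro j
      beta_reduce
      generalize f j = x
      obtain ⟨⟨c, u⟩, hx⟩ := x
      simp only [T', Finset.mem_biUnion, Finset.mem_image, Prod.mk.injEq] at hx
      obtain ⟨v, hv, c', hc', rfl, rfl⟩ := hx
      exact vcomp_hom w _ _ _
    · apply le_antisymm
      · rw [Submodule.span_le]
        rintro _ ⟨j, rfl⟩
        beta_reduce
        generalize f j = x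
        obtain ⟨⟨c, u⟩, hx⟩ := x
        simp only [T', Finset.mem_biUnion, Finset.mem_image, Prod.mk.injEq] at hx
        obtain ⟨v, hv, c', hc', rfl, rfl⟩ := hx
        exact hN _ (by rw [← hT]; exact Submodule.subset_span hv) _
      · rw [← hT, Submodule.span_le]
        intro v hv
        rw [SetLike.mem_coe, hs v]
        refine Submodule.sum_mem _ fun c hc => Submodule.subset_span ?_
        have hm : (c, vcomp w τ c v) ∈ T' := by
          simp only [T', Finset.mem_biUnion, Finset.mem_image, Prod.mk.injEq]
          exact ⟨v, hv, c, hc, rfl, rfl⟩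
        exact ⟨T'.equivFin ⟨_, hm⟩, by simp [f]⟩
  obtain ⟨G, τ', hG, hspan⟩ := Nat.find_spec hP
  have hmin : ∀ m < Nat.find hP, ¬ P m := fun m hm => Nat.find_min hP hm
  generalize Nat.find hP = k at *
  have hA : ∀ r e, IsWeightedHomogeneous w ((Matrix.of fun r j => G j r) r e) (τ' e - τ r) :=
    fun r e => hG e r
  have hmul : ∀ a : Fin k → MvPolynomial σ K, (Matrix.of fun r j => G j r).mulVec a
      = ∑ j, a j • G j := by
    intro a; funext r
    simp [Matrix.mulVec, dotProduct, mul_comm]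
  refine ⟨k, Matrix.of fun r j => G j r, τ', hA, ?_, ?_⟩
  · intro v
    rw [← hspan, Submodule.mem_span_range_iff_exists_fun]
    constructor
    · rintro ⟨c, rfl⟩; exact ⟨c, (hmul c).symm⟩
    · rintro ⟨c, rfl⟩; exact ⟨c, (hmul c).symm⟩
  · intro a ha j
    by_contra hne
    have h1 := vcomp_mulVec w _ hA (τ' j) a
    rw [ha] at h1
    have h0 : vcomp w τ (τ' j) (0 : ι → MvPolynomial σ K) = 0 := by funext e; simp [vcomp]
    rw [h0, hmul] at h1
    have h2 : vcomp w τ' (τ' j) a j = C (constantCoeff (a j)) := by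
      ext m
      simp only [vcomp, coeff_weightedHomogeneousComponent, sub_self, coeff_C]
      by_cases hm : m = 0
      · subst hm; simp [constantCoeff_eq]
      · rw [if_neg (fun h => hm (hpos m h)), if_neg (Ne.symm hm)]
    obtain _ | k := k
    · exact j.elim0
    rw [Fin.sum_univ_succAbove _ j, h2] at h1
    set b := vcomp w τ' (τ' j) a
    set u := constantCoeff (a j)
    refine hmin k (Nat.lt_succ_self k) ⟨fun i => G (j.succAbove i), fun i => τ' (j.succAbove i),
      fun i => hG _, ?_⟩
    have hGj : G j ∈ Submodule.span (MvPolynomial σ K)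
        (Set.range fun i => G (j.succAbove i)) := by
      have : G j = (- C u⁻¹ : MvPolynomial σ K) • ∑ i, b (j.succAbove i) • G (j.succAbove i) := by
        have h3 : ∑ i, b (j.succAbove i) • G (j.succAbove i) = - ((C u : MvPolynomial σ K) • G j) := by
          rw [eq_neg_iff_add_eq_zero, add_comm]; exact h1.symm
        rw [h3, smul_neg, neg_smul, neg_neg, smul_smul, ← C_mul, inv_mul_cancel₀ hne, C_1, one_smul]
      rw [this]
      exact Submodule.smul_mem _ _ (Submodule.sum_mem _ fun i _ =>
        Submodule.smul_mem _ _ (Submodule.subset_span ⟨i, rfl⟩))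
    rw [← hspan]
    apply le_antisymm
    · apply Submodule.span_mono
      rintro _ ⟨i, rfl⟩; exact ⟨_, rfl⟩
    · rw [Submodule.span_le]
      rintro _ ⟨i, rfl⟩
      by_cases hi : i = j
      · rw [hi]; exact hGj
      · obtain ⟨i', rfl⟩ := Fin.exists_succAbove_eq hi
        exact Submodule.subset_span ⟨i', rfl⟩

/-- Graded minimal (possibly infinite) free resolution of `S/J`. -/
structure GRes (J : Ideal (MvPolynomial σ K)) where
  rank : ℕ → ℕ
  tw : (i : ℕ) → Fin (rank i) → Λ
  diff : (i : ℕ) → Matrix (Fin (rank i)) (Fin (rank (i + 1))) (MvPolynomial σ K)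
  rank0 : rank 0 = 1
  tw0 : ∀ e, tw 0 e = 0
  hom : ∀ i r c, IsWeightedHomogeneous w (diff i r c) (tw (i + 1) c - tw i r)
  minimal : ∀ i r c, constantCoeff (diff i r c) = 0
  exact0 : ∀ v : Fin (rank 0) → MvPolynomial σ K,
    (∑ e, v e ∈ J) ↔ ∃ u, v = (diff 0).mulVec u
  exact_succ : ∀ i (v : Fin (rank (i + 1)) → MvPolynomial σ K),
    (diff i).mulVec v = 0 ↔ ∃ u, v = (diff (i + 1)).mulVec u

structure Stage (K : Type) [Field K] where
  r : ℕ
  τ : Fin r → Λ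
  N : Submodule (MvPolynomial σ K) (Fin r → MvPolynomial σ K)
  graded : ∀ v ∈ N, ∀ c, vcomp w τ c v ∈ N
  min : ∀ v ∈ N, ∀ e, constantCoeff (v e) = 0

lemma Stage.exists_next [Finite σ] (hpos : ∀ m : σ →₀ ℕ, Finsupp.weight w m = 0 → m = 0)
    (s : Stage w K) : ∃ (s' : Stage w K) (A : Matrix (Fin s.r) (Fin s'.r) (MvPolynomial σ K)),
      (∀ r e, IsWeightedHomogeneous w (A r e) (s'.τ e - s.τ r)) ∧
      (∀ v, v ∈ s.N ↔ ∃ a, v = A.mulVec a) ∧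
      (∀ a, A.mulVec a = 0 ↔ a ∈ s'.N) := by
  obtain ⟨k, A, τ', h1, h2, h3⟩ := exists_min_gens w hpos s.τ s.N s.graded
  refine ⟨⟨k, τ', LinearMap.ker A.mulVecLin, ?_, ?_⟩, A, h1, h2, ?_⟩
  · intro v hv c
    rw [LinearMap.mem_ker, Matrix.mulVecLin_apply] at hv ⊢
    rw [← vcomp_mulVec w A h1, hv]
    funext e; simp [vcomp]
  · intro v hv
    exact h3 v hv
  · intro a
    rw [LinearMap.mem_ker, Matrix.mulVecLin_apply]

lemma exists_GRes [Finite σ] (hpos : ∀ m : σ →₀ ℕ, Finsupp.weight w m = 0 → m = 0)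
    (J : Ideal (MvPolynomial σ K)) (hJ : ∀ f ∈ J, ∀ c, weightedHomogeneousComponent w c f ∈ J)
    (hJ0 : ∀ f ∈ J, constantCoeff f = 0) : Nonempty (GRes w J) := by
  choose nxt A h1 h2 h3 using Stage.exists_next (K := K) w hpos
  let s0 : Stage w K := ⟨1, fun _ => 0, Submodule.comap (LinearMap.proj
    (R := MvPolynomial σ K) (φ := fun _ : Fin 1 => MvPolynomial σ K) 0) J, by
    intro v hv c
    simp only [Submodule.mem_comap, LinearMap.proj_apply, vcomp, sub_zero] at hv ⊢
    exact hJ _ hv _, by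
    intro v hv e
    rw [Subsingleton.elim e 0]
    exact hJ0 _ hv⟩
  let s : ℕ → Stage w K := fun i => Nat.rec s0 (fun _ => nxt) i
  refine ⟨⟨fun i => (s i).r, fun i => (s i).τ, fun i => A (s i), rfl, fun _ => rfl,
    fun i => h1 (s i), ?_, ?_, ?_⟩⟩
  · intro i r c
    have : A (s i) r c = (A (s i)).mulVec (Pi.single c 1) r := by simp
    rw [this]
    exact (s i).min _ ((h2 (s i) _).2 ⟨_, rfl⟩) r
  · intro v
    rw [← h2 (s 0)]
    change ∑ e : Fin 1, v e ∈ J ↔ v 0 ∈ J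
    simp
  · intro i v
    rw [← h2 (s (i+1))]
    exact h3 (s i) v

end Graded
end

noncomputable section

section Cx
open Matrix
variable {B : Type} [CommRing B]

def RegSeq (I : Ideal B) : List B → Prop
  | [] => True
  | z :: zs => (∀ a, z * a ∈ I → a ∈ I) ∧ RegSeq (I ⊔ Ideal.span {z}) zs

lemma mulVec_mem {α β : Type} [Fintype β] (A : Matrix α β B) (I : Ideal B) (v : β → B)
    (hv : ∀ e, v e ∈ I) (r : α) : (A *ᵥ v) r ∈ I :=
  Ideal.sum_mem _ fun e _ => I.mul_mem_left _ (hv e)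

lemma lin_mem {α β : Type} [Fintype β] (s : (β → B) →ₗ[B] (α → B)) (I : Ideal B) (v : β → B)
    (hv : ∀ e, v e ∈ I) (r : α) : (s v) r ∈ I := by
  classical
  rw [s.pi_apply_eq_sum_univ v, Finset.sum_apply]
  exact Ideal.sum_mem _ fun e _ => I.mul_mem_right _ (hv e)

lemma sup_split {α : Type} (I : Ideal B) (z : B) (v : α → B)
    (hv : ∀ e, v e ∈ I ⊔ Ideal.span {z}) :
    ∃ y u : α → B, (∀ e, y e ∈ I) ∧ v = y + z • u := by
  have : ∀ e, ∃ y u : B, y ∈ I ∧ v e = y + z * u := by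
    intro e
    obtain ⟨y, hy, t, ht, h⟩ := Submodule.mem_sup.1 (hv e)
    obtain ⟨u, rfl⟩ := Ideal.mem_span_singleton'.1 ht
    exact ⟨y, u, hy, by rw [← h, mul_comm]⟩
  choose y u h1 h2 using this
  exact ⟨y, u, h1, funext fun e => h2 e⟩

lemma mem_sup_span {I : Ideal B} {z a b : B} (ha : a ∈ I) : a + z * b ∈ I ⊔ Ideal.span {z} :=
  Submodule.add_mem_sup ha (Ideal.mul_mem_right _ _ (Ideal.mem_span_singleton_self z))

section Chain
variable (ι : ℤ → Type) [∀ i, Fintype (ι i)] (d : ∀ i, Matrix (ι i) (ι (i+1)) B)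

structure Aug (s : ℤ) (I : Ideal B) : Prop where
  emp : ∀ i, i < s → IsEmpty (ι i)
  ne : Nonempty (ι s)
  aug : ∀ v : ι s → B, (∃ w, v = d s *ᵥ w) ↔ ∑ e, v e ∈ I
  cx : ∀ i v, d i *ᵥ (d (i+1) *ᵥ v) = 0
  ex : ∀ i, s ≤ i → ∀ v, d i *ᵥ v = 0 → ∃ w, v = d (i+1) *ᵥ w

def cdiff (θ : B) [∀ i, DecidableEq (ι i)] (i : ℤ) :
    Matrix (ι (i+1) ⊕ ι i) (ι (i+1+1) ⊕ ι (i+1)) B :=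
  Matrix.fromBlocks (d (i+1)) (θ • 1) 0 (- d i)

variable {ι d}

lemma cdiff_mulVec [∀ i, DecidableEq (ι i)] (θ : B) (i : ℤ) (x : ι (i+1+1) → B)
    (y : ι (i+1) → B) :
    cdiff ι d θ i *ᵥ (Sum.elim x y) = Sum.elim (d (i+1) *ᵥ x + θ • y) (- (d i *ᵥ y)) := by
  rw [cdiff, Matrix.fromBlocks_mulVec]
  simp [Matrix.smul_mulVec, Matrix.neg_mulVec]

lemma Aug.cone [∀ i, DecidableEq (ι i)] {s : ℤ} {I : Ideal B} (h : Aug ι d (s+1) I) (θ : B)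
    (hθ : ∀ a, θ * a ∈ I → a ∈ I) :
    Aug (fun i => ι (i+1) ⊕ ι i) (cdiff ι d θ) s (I ⊔ Ideal.span {θ}) := by
  have e1 : IsEmpty (ι s) := h.emp s (by omega)
  refine ⟨?_, ?_, ?_, ?_, ?_⟩
  · intro i hi
    have := h.emp i (by omega)
    have := h.emp (i+1) (by omega)
    infer_instance
  · have := h.ne
    infer_instance
  · intro v
    have hsum : ∑ e, v e = ∑ e, v (Sum.inl e) := by
      simp [Fintype.sum_sum_type]
    rw [hsum]
    constructor
    · rintro ⟨w, hw⟩
      rw [← Sum.elim_comp_inl_inr w, cdiff_mulVec] at hw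
      subst hw
      simp only [Sum.elim_inl, Pi.add_apply, Finset.sum_add_distrib, Pi.smul_apply, smul_eq_mul,
        ← Finset.mul_sum]
      exact mem_sup_span ((h.aug _).1 ⟨_, rfl⟩)
    · intro hv
      obtain ⟨a, ha, t, ht, hab⟩ := Submodule.mem_sup.1 hv
      obtain ⟨b, rfl⟩ := Ideal.mem_span_singleton'.1 ht
      obtain ⟨e0⟩ := h.ne
      obtain ⟨x, hx⟩ := (h.aug (v ∘ Sum.inl - θ • Pi.single e0 b)).2 (by
        simp only [Pi.sub_apply, Finset.sum_sub_distrib, Pi.smul_apply, smul_eq_mul,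
          ← Finset.mul_sum, Finset.sum_pi_single', Finset.mem_univ, if_true, Function.comp]
        rw [← hab]
        simpa [Pi.single_apply, mul_comm] using ha)
      refine ⟨Sum.elim x (Pi.single e0 b), ?_⟩
      rw [cdiff_mulVec, ← hx, ← Sum.elim_comp_inl_inr v]
      congr 1
      · simp
      · exact Subsingleton.elim _ _
  · intro i v
    rw [← Sum.elim_comp_inl_inr v, cdiff_mulVec, cdiff_mulVec]
    funext e
    rcases e with e | e
    · simp [Matrix.mulVec_add, Matrix.mulVec_smul, h.cx]
    · simp [Matrix.mulVec_neg, h.cx]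
  · intro i hi v hv
    rw [← Sum.elim_comp_inl_inr v, cdiff_mulVec] at hv
    have h1 : d (i+1) *ᵥ (v ∘ Sum.inl) + θ • (v ∘ Sum.inr) = 0 :=
      funext fun e => congrFun hv (Sum.inl e)
    have h2 : d i *ᵥ (v ∘ Sum.inr) = 0 :=
      funext fun e => neg_eq_zero.1 (congrFun hv (Sum.inr e))
    have h3 : ∃ u, v ∘ Sum.inr = d (i+1) *ᵥ u := by
      rcases hi.lt_or_eq with hi | rfl
      · exact h.ex i (by omega) _ h2
      · rw [h.aug]
        apply hθ
        rw [Finset.mul_sum]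
        refine (h.aug (θ • (v ∘ Sum.inr))).1 ⟨- (v ∘ Sum.inl), ?_⟩
        rw [Matrix.mulVec_neg]
        exact eq_neg_of_add_eq_zero_right h1
    obtain ⟨u, hu⟩ := h3
    obtain ⟨t, ht⟩ := h.ex (i+1) (by omega) (v ∘ Sum.inl + θ • u) (by
      rw [Matrix.mulVec_add, Matrix.mulVec_smul, ← hu, h1])
    refine ⟨Sum.elim t (-u), ?_⟩
    rw [cdiff_mulVec, ← ht, ← Sum.elim_comp_inl_inr v, hu]
    congr 1
    · simp
    · simp [Matrix.mulVec_neg]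

lemma exact_mod (hcx : ∀ i v, d i *ᵥ (d (i+1) *ᵥ v) = 0) (zs : List B) :
    ∀ (I : Ideal B) (s : ℤ), RegSeq I zs →
    (∀ i, s ≤ i → ∀ v, (∀ e, (d i *ᵥ v) e ∈ I) → ∃ w, ∀ e, (v - d (i+1) *ᵥ w) e ∈ I) →
    (∀ i, s + zs.length ≤ i → ∀ v, (∀ e, (d i *ᵥ v) e ∈ I ⊔ Ideal.ofList zs) →
      ∃ w, ∀ e, (v - d (i+1) *ᵥ w) e ∈ I ⊔ Ideal.ofList zs) := by
  induction zs with
  | nil => intro I s _ h; simpa using h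
  | cons z zs ih =>
    intro I s hz h
    have := ih (I ⊔ Ideal.span {z}) (s+1) hz.2 (by
      intro i hi
      obtain ⟨k, rfl⟩ : ∃ k, i = k + 1 := ⟨i - 1, by ring⟩
      intro v hv
      obtain ⟨y, u, hy, hyu⟩ := sup_split I z _ hv
      have h1 : ∀ e, (d k *ᵥ u) e ∈ I := by
        intro e
        apply hz.1
        have h2 := hcx k v
        rw [hyu, Matrix.mulVec_add, Matrix.mulVec_smul] at h2
        have h3 := congrFun h2 e
        simp only [Pi.add_apply, Pi.smul_apply, smul_eq_mul, Pi.zero_apply] at h3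
        rw [eq_neg_of_add_eq_zero_right h3]
        exact I.neg_mem (mulVec_mem _ _ _ hy _)
      obtain ⟨t, ht⟩ := h k (by omega) u h1
      obtain ⟨p, hp⟩ := h (k+1) (by omega) (v - z • t) (by
        intro e
        have : (d (k+1) *ᵥ (v - z • t)) e = y e + z * (u - d (k+1) *ᵥ t) e := by
          rw [Matrix.mulVec_sub, hyu, Matrix.mulVec_smul]
          simp; ring
        rw [this]
        exact I.add_mem (hy e) (I.mul_mem_left _ (ht e)))
      refine ⟨p, fun e => ?_⟩
      have : (v - d (k+1+1) *ᵥ p) e = (v - z • t - d (k+1+1) *ᵥ p) e + z * t e := by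
        simp; ring
      rw [this]
      exact mem_sup_span (hp e))
    intro i hi
    rw [Ideal.ofList_cons, ← sup_assoc]
    exact this i (by simp at hi; omega)

end Chain

theorem lenA (zs : List B) (hzs : RegSeq ⊥ zs) (h1 : (1 : B) ∉ Ideal.ofList zs) (θs : List B) :
    ∀ (ι : ℤ → Type) [∀ i, Fintype (ι i)] (d : ∀ i, Matrix (ι i) (ι (i+1)) B) (s : ℤ)
      (I : Ideal B), Aug ι d s I → RegSeq I θs → (∀ t ∈ θs, t ∈ Ideal.ofList zs) →
      (∀ i r c, d i r c ∈ Ideal.ofList zs) →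
      ∀ j, s + zs.length - θs.length < j → IsEmpty (ι j) := by
  classical
  induction θs with
  | nil =>
    intro ι _ d s I h _ _ hd j hj
    obtain ⟨k, rfl⟩ : ∃ k, j = k + 1 := ⟨j - 1, by ring⟩
    have := exact_mod (d := d) h.cx zs ⊥ s hzs (by
      intro i hi v hv
      obtain ⟨w, hw⟩ := h.ex i hi v (funext fun e => hv e)
      exact ⟨w, fun e => by rw [← hw]; simp⟩) k (by simp at hj; omega)
    rw [bot_sup_eq] at this
    by_contra hne
    rw [not_isEmpty_iff] at hne
    obtain ⟨e⟩ := hne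
    obtain ⟨w, hw⟩ := this (Pi.single e 1)
      (fun r => Ideal.sum_mem _ fun c _ => Ideal.mul_mem_right _ _ (hd _ _ _))
    have h2 := hw e
    apply h1
    have h3 : (d (k+1) *ᵥ w) e ∈ Ideal.ofList zs :=
      Ideal.sum_mem _ fun c _ => Ideal.mul_mem_right _ _ (hd _ _ _)
    have := Ideal.add_mem _ h2 h3
    simpa using this
  | cons θ θs ih =>
    intro ι _ d s I h hθ hm hd j hj
    obtain ⟨k, rfl⟩ : ∃ k, s = k + 1 := ⟨s - 1, by ring⟩
    have := ih _ _ k _ (h.cone θ hθ.1) hθ.2 (fun t ht => hm t (List.mem_cons_of_mem _ ht)) (by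
      intro i r c
      rcases r with r | r <;> rcases c with c | c
      · exact hd _ _ _
      · simp only [cdiff, Matrix.fromBlocks_apply₁₂, Matrix.smul_apply, smul_eq_mul]
        exact Ideal.mul_mem_right _ _ (hm θ (by simp))
      · simp [cdiff]
      · exact (Ideal.ofList zs).neg_mem (hd _ _ _)) j (by simp at hj; omega)
    exact ⟨fun x => this.false (Sum.inr x)⟩

section Cochain
variable (ι : ℤ → Type) [∀ i, Fintype (ι i)] (d : ∀ i, Matrix (ι (i+1)) (ι i) B)

def NH (g : B) : Prop :=
  ∃ s : ∀ i, (ι (i+1) → B) →ₗ[B] (ι i → B), ∀ i (x : ι (i+1) → B),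
    d i *ᵥ (s i x) + s (i+1) (d (i+1) *ᵥ x) = g • x

def NHI : Ideal B where
  carrier := {g | NH ι d g}
  zero_mem' := ⟨fun _ => 0, fun i x => by simp⟩
  add_mem' := by
    rintro a b ⟨s, hs⟩ ⟨t, ht⟩
    refine ⟨fun i => s i + t i, fun i x => ?_⟩
    rw [add_smul, ← hs, ← ht]
    simp only [LinearMap.add_apply, Matrix.mulVec_add]
    abel
  smul_mem' := by
    rintro c a ⟨s, hs⟩
    refine ⟨fun i => c • s i, fun i x => ?_⟩
    rw [smul_eq_mul, mul_smul, ← hs]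
    simp only [LinearMap.smul_apply, Matrix.mulVec_smul, smul_add]

def kdiff (θ : B) [∀ i, DecidableEq (ι i)] (i : ℤ) :
    Matrix (ι (i+1+1) ⊕ ι (i+1)) (ι (i+1) ⊕ ι i) B :=
  Matrix.fromBlocks (- d (i+1)) 0 (θ • 1) (d i)

variable {ι d}

lemma kdiff_mulVec [∀ i, DecidableEq (ι i)] (θ : B) (i : ℤ) (x : ι (i+1) → B)
    (y : ι i → B) :
    kdiff ι d θ i *ᵥ (Sum.elim x y) = Sum.elim (- (d (i+1) *ᵥ x)) (θ • x + d i *ᵥ y) := by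
  rw [kdiff, Matrix.fromBlocks_mulVec]
  simp [Matrix.smul_mulVec, Matrix.neg_mulVec]

lemma NH.cone [∀ i, DecidableEq (ι i)] {g : B} (h : NH ι d g) (θ : B) :
    NH (fun i => ι (i+1) ⊕ ι i) (kdiff ι d θ) g := by
  obtain ⟨s, hs⟩ := h
  refine ⟨fun i =>
    { toFun := fun x => Sum.elim (- s (i+1) (x ∘ Sum.inl)) (s i (x ∘ Sum.inr))
      map_add' := fun x y => ?_
      map_smul' := fun c x => ?_ }, fun i x => ?_⟩
  · have h1 : (x + y) ∘ Sum.inl = x ∘ Sum.inl + y ∘ (Sum.inl : _ → ι (i+1+1) ⊕ ι (i+1)) := rfl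
    have h2 : (x + y) ∘ Sum.inr = x ∘ Sum.inr + y ∘ (Sum.inr : _ → ι (i+1+1) ⊕ ι (i+1)) := rfl
    rw [h1, h2, map_add, map_add]
    funext e
    rcases e with e | e
    · simp [add_comm]
    · simp
  · have h1 : (c • x) ∘ Sum.inl = c • (x ∘ (Sum.inl : _ → ι (i+1+1) ⊕ ι (i+1))) := rfl
    have h2 : (c • x) ∘ Sum.inr = c • (x ∘ (Sum.inr : _ → ι (i+1+1) ⊕ ι (i+1))) := rfl
    rw [h1, h2, map_smul, map_smul]
    funext e
    rcases e with e | e <;> simp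
  · obtain ⟨a, b, rfl⟩ : ∃ a b, x = Sum.elim a b := ⟨_, _, (Sum.elim_comp_inl_inr x).symm⟩
    simp only [LinearMap.coe_mk, AddHom.coe_mk, Sum.elim_comp_inl, Sum.elim_comp_inr]
    rw [kdiff_mulVec, kdiff_mulVec]
    simp only [Sum.elim_comp_inl, Sum.elim_comp_inr]
    have ha := hs (i+1) a
    have hb := hs i b
    funext e
    rcases e with e | e
    · have := congrFun ha e
      simp only [Pi.add_apply, Sum.elim_inl, Matrix.mulVec_neg, map_neg, neg_neg, Pi.smul_apply]
        at this ⊢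
      exact this
    · have := congrFun hb e
      simp only [Pi.add_apply, Sum.elim_inr, map_add, map_smul, Pi.smul_apply, smul_neg,
        Pi.neg_apply] at this ⊢
      rw [← this]; abel

lemma NH.cone_self [∀ i, DecidableEq (ι i)] (θ : B) :
    NH (fun i => ι (i+1) ⊕ ι i) (kdiff ι d θ) θ := by
  refine ⟨fun i =>
    { toFun := fun x => Sum.elim (x ∘ Sum.inr) 0
      map_add' := fun x y => ?_
      map_smul' := fun c x => ?_ }, fun i x => ?_⟩
  · funext e
    rcases e with e | e <;> simp
  · funext e
    rcases e with e | e <;> simp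
  · obtain ⟨a, b, rfl⟩ : ∃ a b, x = Sum.elim a b := ⟨_, _, (Sum.elim_comp_inl_inr x).symm⟩
    simp only [LinearMap.coe_mk, AddHom.coe_mk, Sum.elim_comp_inl, Sum.elim_comp_inr]
    rw [kdiff_mulVec, kdiff_mulVec]
    funext e
    rcases e with e | e <;> simp

lemma baseB (zs : List B) : ∀ (I : Ideal B) (a : ℤ), RegSeq I zs → (∀ z ∈ zs, NH ι d z) →
    (∀ i v, d (i+1) *ᵥ (d i *ᵥ v) = 0) →
    (∀ i, i < a → IsEmpty (ι i)) →
    ∀ i, i + 1 < a + zs.length → ∀ x : ι (i+1) → B, (∀ e, (d (i+1) *ᵥ x) e ∈ I) →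
      ∃ w, ∀ e, (x - d i *ᵥ w) e ∈ I := by
  induction zs with
  | nil =>
    intro I a _ _ _ he i hi x _
    have := he (i+1) (by simpa using hi)
    exact ⟨0, fun e => isEmptyElim e⟩
  | cons z zs ih =>
    intro I a hz hn hcx he i hi x hx
    have ih' := ih (I ⊔ Ideal.span {z}) a hz.2 (fun t ht => hn t (List.mem_cons_of_mem _ ht)) hcx he
    obtain ⟨s, hs⟩ := hn z (by simp)
    obtain ⟨k, rfl⟩ : ∃ k, i = k + 1 := ⟨i - 1, by ring⟩
    have hsx := hs _ x
    have hsd : ∀ e, (s (k+1+1) (d (k+1+1) *ᵥ x)) e ∈ I := lin_mem _ _ _ hx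
    obtain ⟨w, hw⟩ := ih' k (by simp at hi; omega) (s (k+1) x) (by
      intro e
      rw [eq_sub_of_add_eq hsx]
      have : (z • x - s (k+1+1) (d (k+1+1) *ᵥ x)) e = - (s (k+1+1) (d (k+1+1) *ᵥ x)) e + z * x e := by
        simp; ring
      rw [this]
      exact mem_sup_span (I.neg_mem (hsd e)))
    obtain ⟨y, u, hy, hyu⟩ := sup_split I z _ hw
    refine ⟨u, fun e => hz.1 _ ?_⟩
    have h1 : s (k+1) x = d k *ᵥ w + y + z • u := by
      have := eq_add_of_sub_eq hyu
      rw [this]; abel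
    rw [h1, Matrix.mulVec_add, Matrix.mulVec_add, hcx, Matrix.mulVec_smul] at hsx
    have h2 := congrFun hsx e
    simp only [Pi.add_apply, Pi.zero_apply, Pi.smul_apply, smul_eq_mul, zero_add] at h2
    have : z * (x - d (k+1) *ᵥ u) e = (d (k+1) *ᵥ y) e + s (k+1+1) (d (k+1+1) *ᵥ x) e := by
      rw [Pi.sub_apply, mul_sub, ← h2]; ring
    rw [this]
    exact I.add_mem (mulVec_mem _ _ _ hy _) (hsd e)

end Cochain

theorem dualB [IsNoetherianRing B] (zs : List B) (hzs : RegSeq ⊥ zs) (θs : List B) :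
    ∀ (ι : ℤ → Type) [∀ i, Fintype (ι i)] (d : ∀ i, Matrix (ι (i+1)) (ι i) B) (a : ℤ),
      (∀ i v, d (i+1) *ᵥ (d i *ᵥ v) = 0) → (∀ i, i < a → IsEmpty (ι i)) →
      (∀ t ∈ θs, t ∈ Ideal.jacobson (⊥ : Ideal B)) →
      (∀ z ∈ zs, z ∈ NHI ι d ⊔ Ideal.ofList θs) →
      ∀ i, i + 1 < a + zs.length - θs.length → ∀ x : ι (i+1) → B, d (i+1) *ᵥ x = 0 →
        ∃ w, x = d i *ᵥ w := by
  classical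
  induction θs with
  | nil =>
    intro ι _ d a hcx he _ hz i hi x hx
    obtain ⟨w, hw⟩ := baseB zs ⊥ a hzs (d := d) (fun z h => by
      have := hz z h
      rw [Ideal.ofList_nil, sup_bot_eq] at this
      exact this) hcx he i (by simpa using hi) x (fun e => by rw [hx]; simp)
    exact ⟨w, sub_eq_zero.1 (funext fun e => hw e)⟩
  | cons θ θs ih =>
    intro ι _ d a hcx he hθ hz i hi x hx
    have key := ih (fun i => ι (i+1) ⊕ ι i) (kdiff ι d θ) (a-1) (by
        intro i v
        obtain ⟨a, b, rfl⟩ : ∃ a b, v = Sum.elim a b := ⟨_, _, (Sum.elim_comp_inl_inr v).symm⟩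
        rw [kdiff_mulVec, kdiff_mulVec]
        funext e
        rcases e with e | e
        · simp [Matrix.mulVec_neg, hcx]
        · simp [Matrix.mulVec_add, hcx, Matrix.mulVec_smul]) (by
        intro i hi
        have := he i (by omega)
        have := he (i+1) (by omega)
        infer_instance) (fun t ht => hθ t (List.mem_cons_of_mem _ ht)) (by
        intro z h
        have h1 := hz z h
        rw [Ideal.ofList_cons, ← sup_assoc] at h1
        revert h1
        apply SetLike.le_def.1
        refine sup_le_sup_right (sup_le ?_ ?_) _
        · intro g hg
          exact NH.cone hg θ
        · rw [Ideal.span_singleton_le_iff_mem]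
          exact NH.cone_self θ) i (by simp at hi; omega)
    have := Submodule.le_of_le_smul_of_le_jacobson_bot (I := Ideal.span {θ})
      (N := LinearMap.range (d i).mulVecLin) (N' := LinearMap.ker (d (i+1)).mulVecLin)
      (IsNoetherian.noetherian _)
      (by rw [Ideal.span_singleton_le_iff_mem]; exact hθ θ (by simp)) (by
        intro b hb
        rw [LinearMap.mem_ker, Matrix.mulVecLin_apply] at hb
        obtain ⟨w, hw⟩ := key (Sum.elim 0 b) (by
          rw [kdiff_mulVec, hb]; funext e; rcases e with e | e <;> simp)
        obtain ⟨p, q, rfl⟩ : ∃ a b, w = Sum.elim a b := ⟨_, _, (Sum.elim_comp_inl_inr w).symm⟩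
        rw [kdiff_mulVec] at hw
        have h1 : d (i+1) *ᵥ p = 0 := funext fun e => by
          have := congrFun hw (Sum.inl e)
          simpa using this.symm
        have h2 : b = d i *ᵥ q + θ • p := funext fun e => by
          have := congrFun hw (Sum.inr e)
          simp only [Sum.elim_inr, Pi.add_apply] at this
          rw [this, Pi.add_apply, add_comm]
        rw [h2]
        exact Submodule.add_mem_sup ⟨q, rfl⟩ (Submodule.smul_mem_smul
          (Ideal.mem_span_singleton_self θ) h1))
    obtain ⟨w, hw⟩ := this (show x ∈ _ from hx)
    exact ⟨w, hw.symm⟩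

end Cx
end

noncomputable section

section CommAlg
variable {B : Type} [CommRing B]

lemma RegSeq.dim_le (rs : List B) : ∀ (I : Ideal B), RegSeq I rs →
    ringKrullDim (B ⧸ (I ⊔ Ideal.ofList rs)) + (rs.length : ℕ) ≤ ringKrullDim (B ⧸ I) := by
  induction rs with
  | nil =>
    intro I _
    rw [Ideal.ofList_nil, sup_bot_eq]; simp
  | cons z zs ih =>
    intro I h
    have h1 := ih _ h.2
    have h2 : ringKrullDim (B ⧸ (I ⊔ Ideal.span {z})) + 1 ≤ ringKrullDim (B ⧸ I) := by
      have hz : Ideal.Quotient.mk I z ∈ nonZeroDivisors (B ⧸ I) := by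
        rw [mem_nonZeroDivisors_iff_right]
        intro x hx
        obtain ⟨x, rfl⟩ := Ideal.Quotient.mk_surjective x
        rw [← map_mul, Ideal.Quotient.eq_zero_iff_mem] at hx
        rw [Ideal.Quotient.eq_zero_iff_mem]
        exact h.1 _ (by rwa [mul_comm])
      have h3 := ringKrullDim_quotient_succ_le_of_nonZeroDivisor hz
      have e := DoubleQuot.quotQuotEquivQuotSup I (Ideal.span {z})
      rw [Ideal.map_span, Set.image_singleton] at e
      rwa [ringKrullDim_eq_of_ringEquiv e] at h3
    rw [Ideal.ofList_cons, ← sup_assoc, List.length_cons]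
    refine le_trans ?_ h2
    push_cast
    rw [← add_assoc]
    gcongr

lemma RegSeq.of_take (rs : List B) : ∀ I : Ideal B,
    (∀ i (h : i < rs.length), ∀ a, rs[i] * a ∈ I ⊔ Ideal.ofList (rs.take i) →
      a ∈ I ⊔ Ideal.ofList (rs.take i)) → RegSeq I rs := by
  induction rs with
  | nil => intro I _; trivial
  | cons z zs ih =>
    intro I h
    refine ⟨?_, ih _ ?_⟩
    · have := h 0 (by simp)
      simpa using this
    · intro i hi
      have := h (i+1) (by simpa using hi)
      simpa [Ideal.ofList_cons, sup_assoc] using this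

lemma RegSeq.of_isRegular {I : Ideal B} {rs : List B}
    (h : RingTheory.Sequence.IsWeaklyRegular (B ⧸ I) rs) : RegSeq I rs := by
  apply RegSeq.of_take
  intro i hi a ha
  have h1 := h.regular_mod_prev i hi
  have key : ∀ b : B, (Submodule.Quotient.mk (Ideal.Quotient.mk I b) :
      (B ⧸ I) ⧸ (Ideal.ofList (rs.take i) • ⊤ : Submodule B (B ⧸ I))) = 0 ↔
      b ∈ I ⊔ Ideal.ofList (rs.take i) := by
    intro b
    rw [Submodule.Quotient.mk_eq_zero, Ideal.smul_top_eq_map]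
    change Ideal.Quotient.mk I b ∈ Ideal.map (Ideal.Quotient.mk I) _ ↔ _
    rw [Ideal.mem_quotient_iff_mem_sup, sup_comm]
  rw [← key] at ha ⊢
  apply h1
  change _ = rs[i] • _
  rw [smul_zero, ← ha]
  rfl

lemma RegSeq.map_loc [IsDomain B] {L : Type} [CommRing L] [Algebra B L] (M : Submonoid B)
    [IsLocalization M L] (hM : M ≤ nonZeroDivisors B) (rs : List B) : ∀ I : Ideal B, RegSeq I rs →
      RegSeq (I.map (algebraMap B L)) (rs.map (algebraMap B L)) := by
  have hinj : Function.Injective (algebraMap B L) := IsLocalization.injective L hM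
  induction rs with
  | nil => intro I _; trivial
  | cons z zs ih =>
    intro I h
    refine ⟨?_, ?_⟩
    · intro a ha
      obtain ⟨⟨x, s⟩, hx⟩ := IsLocalization.surj M a
      obtain ⟨⟨y, t⟩, hy⟩ := (IsLocalization.mem_map_algebraMap_iff M L).1 ha
      simp only at hx hy
      have h3 : z * (x * t) = s * y := by
        apply hinj
        simp only [map_mul]
        rw [← hx, ← hy]; ring
      have h4 : x * t ∈ I := h.1 _ (by rw [h3]; exact I.mul_mem_left _ y.2)
      refine (IsLocalization.mem_map_algebraMap_iff M L).2 ⟨⟨⟨x * t, h4⟩, s * t⟩, ?_⟩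
      simp only [Submonoid.coe_mul, map_mul]
      rw [← hx]; ring
    · have := ih _ h.2
      rwa [Ideal.map_sup, Ideal.map_span, Set.image_singleton] at this

end CommAlg

section Poly
variable {σ K : Type} [Field K]

/-- monomial ideal of k-th powers of variables -/
def powI (K : Type) [Field K] (k : ℕ) (A : Set σ) : Ideal (MvPolynomial σ K) :=
  Ideal.span ((fun s => monomial s (1 : K)) '' ((fun i => Finsupp.single i k) '' A))

lemma mem_powI {k : ℕ} {A : Set σ} {f : MvPolynomial σ K} :
    f ∈ powI K k A ↔ ∀ m, coeff m f ≠ 0 → ∃ i ∈ A, k ≤ m i := by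
  rw [powI, mem_ideal_span_monomial_image]
  simp [Finsupp.single_le_iff]

lemma powI_reg {k : ℕ} {A : Set σ} {i : σ} (hi : i ∉ A) (f : MvPolynomial σ K)
    (hf : X i ^ k * f ∈ powI K k A) : f ∈ powI K k A := by
  rw [mem_powI] at hf ⊢
  intro m hm
  obtain ⟨j, hj, h⟩ := hf (Finsupp.single i k + m) (by
    rw [X_pow_eq_monomial, coeff_monomial_mul, one_mul]; exact hm)
  refine ⟨j, hj, ?_⟩
  have hij : i ≠ j := fun h => hi (h ▸ hj)
  simpa [hij] using h

lemma powI_insert {k : ℕ} {A : Set σ} {i : σ} :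
    powI K k A ⊔ Ideal.span {X i ^ k} = powI K k (insert i A) := by
  rw [powI, powI, ← Ideal.span_union, Set.image_insert_eq, Set.image_insert_eq, X_pow_eq_monomial,
    Set.union_comm]
  rfl

lemma regSeq_pow (k : ℕ) (l : List σ) : ∀ A : Set σ, l.Nodup → (∀ i ∈ l, i ∉ A) →
    RegSeq (powI K k A) (l.map fun i => (X i : MvPolynomial σ K) ^ k) := by
  induction l with
  | nil => intro A _ _; trivial
  | cons i l ih =>
    intro A h hA
    rw [List.nodup_cons] at h
    refine ⟨powI_reg (hA i (by simp)), ?_⟩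
    rw [powI_insert]
    apply ih _ h.2
    intro j hj hjA
    rcases hjA with rfl | hjA
    · exact h.1 hj
    · exact hA j (List.mem_cons_of_mem _ hj) hjA

lemma regSeq_pow_bot (k : ℕ) (l : List σ) (h : l.Nodup) :
    RegSeq ⊥ (l.map fun i => (X i : MvPolynomial σ K) ^ k) := by
  have := regSeq_pow (K := K) k l ∅ h (by simp)
  simpa [powI] using this

lemma ofList_X_le (l : List σ) (h : ∀ i, i ∈ l) :
    Ideal.ofList (l.map fun i => (X i : MvPolynomial σ K) ^ 1) =
      RingHom.ker (constantCoeff (σ := σ) (R := K)) := by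
  have : Ideal.ofList (l.map fun i => (X i : MvPolynomial σ K) ^ 1) = powI K 1 Set.univ := by
    rw [powI, Ideal.ofList]
    congr 1
    ext f
    simp only [List.mem_map, Set.mem_ofPred_eq, Set.image_univ, Set.mem_image, Set.mem_range,
      X_pow_eq_monomial]
    constructor
    · rintro ⟨i, _, rfl⟩; exact ⟨_, ⟨i, rfl⟩, rfl⟩
    · rintro ⟨_, ⟨i, rfl⟩, rfl⟩; exact ⟨i, h i, rfl⟩
  rw [this]
  ext f
  rw [mem_powI, RingHom.mem_ker, constantCoeff_eq]
  constructor
  · intro h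
    by_contra h2
    obtain ⟨i, _, hi⟩ := h 0 h2
    simp at hi
  · intro h m hm
    by_contra! h2
    apply hm
    have : m = 0 := by ext i; have := h2 i trivial; simp; omega
    rw [this, h]

instance maxPrime : (RingHom.ker (constantCoeff (σ := σ) (R := K))).IsMaximal :=
  RingHom.ker_isMaximal_of_surjective _ fun c => ⟨C c, by simp⟩

/-- In the local ring, powers of variables lie in an ideal of dimension zero. -/
lemma exists_pow_mem [Finite σ] (I : Ideal (MvPolynomial σ K))
    (hdim : ringKrullDim (MvPolynomial σ K ⧸ I) ≤ 0) :
    ∃ k, ∀ i, algebraMap (MvPolynomial σ K) (Localization.AtPrime (RingHom.ker (constantCoeff (σ := σ) (R := K))))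
      (X i ^ k) ∈ I.map (algebraMap (MvPolynomial σ K) (Localization.AtPrime
        (RingHom.ker (constantCoeff (σ := σ) (R := K))))) := by
  set m := RingHom.ker (constantCoeff (σ := σ) (R := K)) with hm
  set L := Localization.AtPrime m
  have h1 : ∀ i, algebraMap (MvPolynomial σ K) L (X i) ∈ (I.map (algebraMap _ L)).radical := by
    intro i
    rw [Ideal.radical_eq_sInf, Submodule.mem_sInf]
    rintro (P : Ideal L) ⟨hP, hPp⟩
    have hq : (P.comap (algebraMap (MvPolynomial σ K) L)).IsPrime := inferInstance
    have hIq : I ≤ P.comap (algebraMap (MvPolynomial σ K) L) := Ideal.map_le_iff_le_comap.1 hP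
    have hqm : P.comap (algebraMap (MvPolynomial σ K) L) ≤ m := by
      intro x hx
      by_contra hxm
      apply hPp.ne_top
      exact Ideal.eq_top_of_isUnit_mem _ hx
        (IsLocalization.map_units L (⟨x, hxm⟩ : m.primeCompl))
    have hmax : (P.comap (algebraMap (MvPolynomial σ K) L)).IsMaximal := by
      have : Ring.KrullDimLE 0 (MvPolynomial σ K ⧸ I) := Ring.krullDimLE_iff.2 (by simpa using hdim)
      set q := P.comap (algebraMap (MvPolynomial σ K) L)
      have hp : (q.map (Ideal.Quotient.mk I)).IsPrime :=
        Ideal.map_isPrime_of_surjective Ideal.Quotient.mk_surjective (by simpa using hIq)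
      have hc := Ideal.comap_isMaximal_of_surjective (Ideal.Quotient.mk I)
        Ideal.Quotient.mk_surjective (K := q.map (Ideal.Quotient.mk I)) (H := hp.isMaximal')
      rwa [Ideal.comap_map_of_surjective _ Ideal.Quotient.mk_surjective, ← RingHom.ker_eq_comap_bot,
        Ideal.mk_ker, sup_eq_left.2 hIq] at hc
    have heq := hmax.eq_of_le (maxPrime (σ := σ) (K := K)).ne_top hqm
    change X i ∈ P.comap (algebraMap (MvPolynomial σ K) L)
    rw [heq, ← hm, hm, RingHom.mem_ker]
    simp
  choose k hk using h1
  have := Fintype.ofFinite σ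
  refine ⟨∑ i, k i, fun i => ?_⟩
  rw [map_pow]
  exact Ideal.pow_mem_of_pow_mem _ (hk i) (Finset.single_le_sum (fun _ _ => Nat.zero_le _) (Finset.mem_univ i))

/-- extract the maximal regular sequence. -/
lemma exists_theta (J : Ideal (MvPolynomial σ K))
    (hJ0 : ∀ f ∈ J, constantCoeff f = 0)
    (h : (quotientDepth J : WithBot (WithTop ℕ)) = ringKrullDim (MvPolynomial σ K ⧸ J)) :
    ∃ θs : List (MvPolynomial σ K), (∀ r ∈ θs, constantCoeff r = 0) ∧ RegSeq J θs ∧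
      ringKrullDim (MvPolynomial σ K ⧸ (J ⊔ Ideal.ofList θs)) ≤ 0 := by
  replace h : ((quotientDepth J : ℕ) : WithBot ℕ∞) = ringKrullDim (MvPolynomial σ K ⧸ J) := h
  have hle : ∀ rs : List (MvPolynomial σ K), (∀ r ∈ rs, constantCoeff r = 0) →
      J ⊔ Ideal.ofList rs ≤ RingHom.ker (constantCoeff (σ := σ) (R := K)) := by
    intro rs hrs
    refine sup_le (fun f hf => hJ0 f hf) (Ideal.span_le.2 fun r hr => hrs r hr)
  have hmem : quotientDepth J ∈ {d : ℕ | ∃ rs : List (MvPolynomial σ K), rs.length = d ∧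
    (∀ r ∈ rs, constantCoeff r = 0) ∧
    RingTheory.Sequence.IsRegular (MvPolynomial σ K ⧸ J) rs} := by
    apply Nat.sSup_mem
    · refine ⟨0, [], rfl, by simp, ⟨⟨fun i hi => by simp at hi⟩, ?_⟩⟩
      have hn : Nontrivial (MvPolynomial σ K ⧸ J) := by
        apply Ideal.Quotient.nontrivial_iff.2
        intro h1
        have := hJ0 1 (by rw [h1]; trivial)
        simp at this
      simp
    · refine ⟨quotientDepth J, ?_⟩
      rintro _ ⟨rs, rfl, h0, hr⟩
      have h1 := (RegSeq.of_isRegular hr.toIsWeaklyRegular).dim_le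
      rw [← h] at h1
      have hn : Nontrivial (MvPolynomial σ K ⧸ (J ⊔ Ideal.ofList rs)) := by
        apply Ideal.Quotient.nontrivial_iff.2
        intro h2
        have := hle rs h0 (by rw [h2]; trivial : (1 : MvPolynomial σ K) ∈ J ⊔ Ideal.ofList rs)
        simp [RingHom.mem_ker] at this
      have h3 : (0 : WithBot ℕ∞) ≤ ringKrullDim (MvPolynomial σ K ⧸ (J ⊔ Ideal.ofList rs)) :=
        ringKrullDim_nonneg_of_nontrivial
      have h4 : ((rs.length : ℕ) : WithBot ℕ∞) ≤ (quotientDepth J : ℕ) := by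
        refine le_trans ?_ h1
        calc ((rs.length : ℕ) : WithBot ℕ∞) = 0 + (rs.length : ℕ) := by simp
          _ ≤ _ := by gcongr
      exact_mod_cast h4
  obtain ⟨rs, h1, h2, h3⟩ := hmem
  refine ⟨rs, h2, RegSeq.of_isRegular h3.toIsWeaklyRegular, ?_⟩
  have h4 := (RegSeq.of_isRegular h3.toIsWeaklyRegular).dim_le
  rw [← h, ← h1] at h4
  generalize ringKrullDim (MvPolynomial σ K ⧸ (J ⊔ Ideal.ofList rs)) = x at h4
  induction x with
  | bot => simp
  | coe x =>
    have h5 : ((x : ℕ∞) : WithBot ℕ∞) + ((rs.length : ℕ∞) : WithBot ℕ∞)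
      ≤ ((rs.length : ℕ∞) : WithBot ℕ∞) := h4
    rw [← WithBot.coe_add, WithBot.coe_le_coe] at h5
    rw [← WithBot.coe_zero, WithBot.coe_le_coe]
    induction x with
    | top => simp at h5
    | coe x =>
      have : x + rs.length ≤ rs.length := by exact_mod_cast h5
      have : x = 0 := by omega
      subst this; simp

end Poly
end

noncomputable section

section ZInd
open Matrix
variable {B : Type} [CommRing B]

def zι (r : ℕ → ℕ) : ℤ → Type
  | .ofNat k => Fin (r k)
  | .negSucc _ => Empty

instance zιF (r : ℕ → ℕ) : ∀ i, Fintype (zι r i)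
  | .ofNat k => inferInstanceAs (Fintype (Fin (r k)))
  | .negSucc _ => inferInstanceAs (Fintype Empty)

def zd (r : ℕ → ℕ) (A : ∀ k, Matrix (Fin (r k)) (Fin (r (k+1))) B) :
    ∀ i, Matrix (zι r i) (zι r (i+1)) B
  | .ofNat k => A k
  | .negSucc _ => fun e => Empty.elim e

def zc (r : ℕ → ℕ) (A : ∀ k, Matrix (Fin (r k)) (Fin (r (k+1))) B) :
    ∀ i, Matrix (zι r (i+1)) (zι r i) B := fun i => (zd r A i)ᵀ

def zs (r : ℕ → ℕ) (s : ∀ k, Matrix (Fin (r (k+1))) (Fin (r k)) B) :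
    ∀ i, Matrix (zι r i) (zι r (i+1)) B
  | .ofNat k => (s k)ᵀ
  | .negSucc _ => fun e => Empty.elim e

lemma zι_emp (r : ℕ → ℕ) : ∀ i, i < 0 → IsEmpty (zι r i)
  | .ofNat k, h => absurd h (by simp)
  | .negSucc _, _ => inferInstanceAs (IsEmpty Empty)

lemma zc_cx (r : ℕ → ℕ) (A : ∀ k, Matrix (Fin (r k)) (Fin (r (k+1))) B)
    (h : ∀ k, A k * A (k+1) = 0) : ∀ i v, zc r A (i+1) *ᵥ (zc r A i *ᵥ v) = 0
  | .ofNat k, v => by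
    have : ∀ v : Fin (r k) → B, (A (k+1))ᵀ *ᵥ ((A k)ᵀ *ᵥ v) = 0 := by
      intro v
      rw [Matrix.mulVec_mulVec, ← Matrix.transpose_mul, h]; simp
    exact this v
  | .negSucc k, v => by
    have : v = 0 := funext fun e => Empty.elim e
    rw [this]; simp

lemma zc_NH (r : ℕ → ℕ) (A : ∀ k, Matrix (Fin (r k)) (Fin (r (k+1))) B)
    (s : ∀ k, Matrix (Fin (r (k+1))) (Fin (r k)) B) (g : B)
    (h0 : A 0 * s 0 = g • 1) (h : ∀ k, A (k+1) * s (k+1) + s k * A k = g • 1) :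
    NH (zι r) (zc r A) g := by
  refine ⟨fun i => (zs r s i).mulVecLin, ?_⟩
  intro i
  match i with
  | .ofNat k =>
    have : ∀ x : Fin (r (k+1)) → B,
      (A k)ᵀ *ᵥ ((s k)ᵀ *ᵥ x) + (s (k+1))ᵀ *ᵥ ((A (k+1))ᵀ *ᵥ x) = g • x := by
     intro x
     rw [Matrix.mulVec_mulVec, Matrix.mulVec_mulVec, ← Matrix.transpose_mul, ← Matrix.transpose_mul,
      ← Matrix.add_mulVec, ← Matrix.transpose_add,
      (show s k * A k + A (k+1) * s (k+1) = g • 1 by rw [← h k]; exact add_comm _ _)]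
     simp [Matrix.smul_mulVec]
    exact this
  | .negSucc 0 =>
    intro x
    have : zs r s (Int.negSucc 0) *ᵥ x = 0 := funext fun e => Empty.elim e
    rw [Matrix.mulVecLin_apply, this, Matrix.mulVec_zero, zero_add]
    have : ∀ x : Fin (r 0) → B, (s 0)ᵀ *ᵥ ((A 0)ᵀ *ᵥ x) = g • x := by
      intro x
      rw [Matrix.mulVec_mulVec, ← Matrix.transpose_mul, h0]
      simp [Matrix.smul_mulVec]
    exact this x
  | .negSucc (k+1) =>
    intro x
    have := zι_emp r (Int.negSucc (k+1) + 1) (by omega)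
    funext e
    exact isEmptyElim e

end ZInd

section Res
open Matrix
variable {σ K Λ : Type} [Field K] [AddCommGroup Λ] {w : σ → Λ} {J : Ideal (MvPolynomial σ K)}

lemma GRes.sq (F : GRes w J) (k : ℕ) : F.diff k * F.diff (k+1) = 0 := by
  ext1 r c
  have := (F.exact_succ k (F.diff (k+1) *ᵥ Pi.single c 1)).2 ⟨_, rfl⟩
  rw [Matrix.mulVec_mulVec] at this
  have := congrFun this r
  simpa using this

lemma GRes.aug (F : GRes w J) : Aug (zι F.rank) (zd F.rank F.diff) 0 J := by
  refine ⟨zι_emp _, ?_, ?_, ?_, ?_⟩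
  · exact ⟨(⟨0, by rw [F.rank0]; exact one_pos⟩ : Fin (F.rank 0))⟩
  · intro v
    exact (F.exact0 v).symm
  · intro i
    match i with
    | .ofNat k =>
      have : ∀ v, F.diff k *ᵥ (F.diff (k+1) *ᵥ v) = 0 := by
        intro v
        rw [Matrix.mulVec_mulVec, F.sq]; simp
      exact this
    | .negSucc _ => intro v; exact funext fun e => Empty.elim e
  · intro i
    match i with
    | .ofNat k =>
      intro _ v hv
      exact (F.exact_succ k v).1 hv
    | .negSucc k => intro h; exact absurd h (by simp)

lemma GRes.lift (F : GRes w J) (k : ℕ) {α : Type} (A : Matrix (Fin (F.rank (k+1))) α (MvPolynomial σ K))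
    (hA : F.diff k * A = 0) : ∃ W : Matrix (Fin (F.rank (k+1+1))) α (MvPolynomial σ K), A = F.diff (k+1) * W := by
  have : ∀ c, ∃ u, (fun r => A r c) = F.diff (k+1) *ᵥ u := by
    intro c
    rw [← F.exact_succ]
    funext r
    have := congrFun (congrFun hA r) c
    simpa [Matrix.mul_apply, Matrix.mulVec, dotProduct] using this
  choose u hu using this
  refine ⟨Matrix.of fun r c => u c r, ?_⟩
  ext1 r c
  have := congrFun (hu c) r
  simpa [Matrix.mul_apply, Matrix.mulVec, dotProduct] using this

lemma GRes.homotopy (F : GRes w J) {g : MvPolynomial σ K} (hg : g ∈ J) :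
    ∃ s : ∀ k, Matrix (Fin (F.rank (k+1))) (Fin (F.rank k)) (MvPolynomial σ K),
      F.diff 0 * s 0 = g • 1 ∧ ∀ k, F.diff (k+1) * s (k+1) + s k * F.diff k = g • 1 := by
  have h0 : ∃ s0 : Matrix (Fin (F.rank 1)) (Fin (F.rank 0)) (MvPolynomial σ K), F.diff 0 * s0 = g • 1 := by
    have : ∀ c : Fin (F.rank 0), ∃ u, (Pi.single c g : Fin (F.rank 0) → MvPolynomial σ K)
        = F.diff 0 *ᵥ u := by
      intro c
      rw [← F.exact0]
      simpa using hg
    choose u hu using this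
    refine ⟨Matrix.of fun r c => u c r, ?_⟩
    ext1 r c
    have := congrFun (hu c) r
    rw [Matrix.mul_apply, Matrix.smul_apply, Matrix.one_apply]
    rw [Pi.single_apply, Matrix.mulVec, dotProduct] at this
    simp only [Matrix.of_apply]
    rw [← this]
    split_ifs <;> simp
  obtain ⟨s0, hs0⟩ := h0
  let T : ℕ → Type := fun k => {s : Matrix (Fin (F.rank (k+1))) (Fin (F.rank k)) (MvPolynomial σ K) //
    F.diff k * s * F.diff k = g • F.diff k}
  have hstep : ∀ k (s : T k), ∃ t : T (k+1), F.diff (k+1) * t.1 + s.1 * F.diff k = g • 1 := by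
    intro k s
    obtain ⟨W, hW⟩ := F.lift k (g • 1 - s.1 * F.diff k) (by
      rw [Matrix.mul_sub, ← Matrix.mul_assoc, s.2]; simp)
    refine ⟨⟨W, ?_⟩, ?_⟩
    · rw [← hW, Matrix.sub_mul, Matrix.mul_assoc, F.sq]; simp
    · simp only; rw [← hW]; simp
  choose nxt hnxt using hstep
  let s : ∀ k, T k := fun k => Nat.rec ⟨s0, by rw [hs0]; simp⟩ (fun k t => nxt k t) k
  exact ⟨fun k => (s k).1, hs0, fun k => hnxt k (s k)⟩

theorem GRes.main [Fintype σ] (hpos : ∀ m : σ →₀ ℕ, Finsupp.weight w m = 0 → m = 0)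
    (F : GRes w J) (hJ0 : ∀ f ∈ J, constantCoeff f = 0)
    (h : (quotientDepth J : WithBot (WithTop ℕ)) = ringKrullDim (MvPolynomial σ K ⧸ J)) :
    ∃ q : ℤ, (∀ k : ℕ, q < k → F.rank k = 0) ∧
      (0 < q → ∀ x, (F.diff 0)ᵀ *ᵥ x = 0 → x = 0) ∧
      (∀ k : ℕ, k + 1 < q → ∀ c x, VHom w (fun e => - F.tw (k+1) e) c x →
        (F.diff (k+1))ᵀ *ᵥ x = 0 → ∃ y, VHom w (fun e => - F.tw k e) c y ∧ x = (F.diff k)ᵀ *ᵥ y) := by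
  classical
  obtain ⟨θs, hθ0, hθ, hdim⟩ := exists_theta J hJ0 h
  set l := (Finset.univ : Finset σ).toList with hl
  have hlen : l.length = Fintype.card σ := by simp [hl]
  have hnd : l.Nodup := Finset.nodup_toList _
  have hall : ∀ i, i ∈ l := by simp [hl]
  refine ⟨Fintype.card σ - θs.length, ?_, ?_⟩
  · intro k hk
    have := lenA (l.map fun i => (X i : MvPolynomial σ K) ^ 1) (regSeq_pow_bot 1 l hnd) (by
      rw [ofList_X_le l hall]; simp [RingHom.mem_ker]) θs _ _ _ _ F.aug hθ (by
      rw [ofList_X_le l hall]; exact hθ0) (by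
      rw [ofList_X_le l hall]
      intro i
      match i with
      | .ofNat k => exact F.minimal k
      | .negSucc _ => intro e; exact Empty.elim e) (Int.ofNat k) (by
        simp [hlen]; omega)
    by_contra h0
    exact this.false (⟨0, Nat.pos_of_ne_zero h0⟩ : Fin (F.rank k))
  set m := RingHom.ker (constantCoeff (σ := σ) (R := K)) with hm
  set L := Localization.AtPrime m
  have hMnz : m.primeCompl ≤ nonZeroDivisors (MvPolynomial σ K) := Ideal.primeCompl_le_nonZeroDivisors m
  have hinj : Function.Injective (algebraMap (MvPolynomial σ K) L) :=
    IsLocalization.injective L hMnz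
  obtain ⟨k, hk⟩ := exists_pow_mem _ hdim
  have : IsNoetherianRing L := IsLocalization.isNoetherianRing m.primeCompl L inferInstance
  let A : ∀ k, Matrix (Fin (F.rank k)) (Fin (F.rank (k+1))) L :=
    fun k => (F.diff k).map (algebraMap (MvPolynomial σ K) L)
  have key := dualB ((l.map fun i => (X i : MvPolynomial σ K) ^ k).map (algebraMap (MvPolynomial σ K) L))
    (by
      have := (regSeq_pow_bot (K := K) k l hnd).map_loc (L := L) m.primeCompl hMnz
      rwa [Ideal.map_bot] at this) (θs.map (algebraMap (MvPolynomial σ K) L))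
    (zι F.rank) (zc F.rank A) 0 (zc_cx _ _ (by
      intro k
      rw [← Matrix.map_mul, F.sq]; simp)) (zι_emp _) (by
      intro t ht
      obtain ⟨r, hr, rfl⟩ := List.mem_map.1 ht
      rw [IsLocalRing.jacobson_eq_maximalIdeal _ bot_ne_top]
      rw [IsLocalization.AtPrime.to_map_mem_maximal_iff L m]
      exact hθ0 r hr) (by
      intro z hz
      obtain ⟨_, hz', rfl⟩ := List.mem_map.1 hz
      obtain ⟨i, _, rfl⟩ := List.mem_map.1 hz'
      refine SetLike.le_def.1 ?_ (hk i)
      rw [Ideal.map_sup]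
      refine sup_le_sup ?_ ?_
      · rw [Ideal.map_le_iff_le_comap]
        intro g hg
        obtain ⟨s, hs0, hs⟩ := F.homotopy hg
        refine zc_NH F.rank A (fun k => (s k).map (algebraMap (MvPolynomial σ K) L)) _ ?_ ?_
        · rw [← Matrix.map_mul, hs0]
          ext1 r c
          simp only [Matrix.map_apply, Matrix.smul_apply, Matrix.one_apply]
          split_ifs <;> simp <;> rfl
        · intro k
          rw [← Matrix.map_mul, ← Matrix.map_mul, ← Matrix.map_add _ (map_add _), hs]
          ext1 r c
          simp only [Matrix.map_apply, Matrix.smul_apply, Matrix.one_apply]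
          split_ifs <;> simp <;> rfl
      · rw [Ideal.map_ofList])
  simp only [List.length_map, hlen, zero_add] at key
  have hmap : ∀ (k : ℕ) (x : Fin (F.rank k) → MvPolynomial σ K),
      (A k)ᵀ *ᵥ (fun e => algebraMap (MvPolynomial σ K) L (x e)) =
      fun e => algebraMap (MvPolynomial σ K) L (((F.diff k)ᵀ *ᵥ x) e) := by
    intro k x; funext e
    simp [A, Matrix.mulVec, dotProduct]
  constructor
  · intro hq x hx
    obtain ⟨u, hu⟩ := key (Int.negSucc 0) (by simpa using hq)
      (show Fin (F.rank 0) → L from fun e => algebraMap (MvPolynomial σ K) L (x e)) (by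
        change (A 0)ᵀ *ᵥ _ = 0
        rw [hmap, hx]; simp; rfl)
    funext e
    apply hinj
    rw [Pi.zero_apply, map_zero]
    have h1 := congrFun hu e
    rw [h1]
    have : u = 0 := funext fun a => Empty.elim a
    rw [this, Matrix.mulVec_zero]
    rfl
  · intro k hkq c x hx hdx
    obtain ⟨u, hu⟩ := key (Int.ofNat k) (by simpa using hkq)
      (show Fin (F.rank (k+1)) → L from fun e => algebraMap (MvPolynomial σ K) L (x e)) (by
        change (A (k+1))ᵀ *ᵥ _ = 0
        rw [hmap, hdx]; simp; rfl)
    replace hu : (fun e => algebraMap (MvPolynomial σ K) L (x e)) = (A k)ᵀ *ᵥ (u : Fin (F.rank k) → L) := hu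
    change Fin (F.rank k) → L at u
    obtain ⟨f, hf⟩ := IsLocalization.exist_integer_multiples_of_finite m.primeCompl u
    choose y hy using hf
    have h1 : (f : MvPolynomial σ K) • x = (F.diff k)ᵀ *ᵥ y := by
      funext e
      apply hinj
      have h2 := congrFun (hmap k y) e
      rw [← h2]
      have h3 : (fun e => algebraMap (MvPolynomial σ K) L (y e))
          = (algebraMap (MvPolynomial σ K) L (f : MvPolynomial σ K)) • u := by
        funext e; rw [hy]; simp [Algebra.smul_def]
      rw [h3, Matrix.mulVec_smul, ← hu]
      simp
    have hA : ∀ r e, IsWeightedHomogeneous w ((F.diff k)ᵀ r e) ((- F.tw k e) - (- F.tw (k+1) r)) := by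
      intro r e
      have := F.hom k e r
      rw [Matrix.transpose_apply]
      convert this using 1
      abel
    have h2 := congrArg (vcomp w (fun e => - F.tw (k+1) e) c) h1
    rw [vcomp_mulVec w (τ' := fun e => - F.tw k e) _ hA] at h2
    have hf0 : constantCoeff (f : MvPolynomial σ K) ≠ 0 := f.2
    have h3 : vcomp w (fun e => - F.tw (k+1) e) c ((f : MvPolynomial σ K) • x)
        = (C (constantCoeff (f : MvPolynomial σ K)) : MvPolynomial σ K) • x := by
      funext e
      simp only [vcomp, Pi.smul_apply, smul_eq_mul]
      rw [mul_comm, whc_mul w (hx e), sub_self, mul_comm]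
      congr 1
      ext m
      simp only [coeff_weightedHomogeneousComponent, coeff_C]
      by_cases hm : m = 0
      · subst hm; simp [constantCoeff_eq]
      · rw [if_neg (fun h => hm (hpos m h)), if_neg (Ne.symm hm)]
    rw [h3] at h2
    set a := constantCoeff (f : MvPolynomial σ K)
    refine ⟨(C a⁻¹ : MvPolynomial σ K) • vcomp w (fun e => - F.tw k e) c y, ?_, ?_⟩
    · intro e
      have h4 := (isWeightedHomogeneous_C w a⁻¹).mul (vcomp_hom w (fun e => - F.tw k e) c y e)
      rw [zero_add] at h4
      exact h4
    · rw [Matrix.mulVec_smul, ← h2, smul_smul, ← C_mul, inv_mul_cancel₀ hf0, C_1, one_smul]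

end Res
end

noncomputable section

section Frozen
open Matrix
variable {σ K Λ : Type} [Field K] [AddCommGroup Λ] {w : σ → Λ} {J : Ideal (MvPolynomial σ K)}

lemma whom_to_hom (φ : Λ →+ ℤ) (hφ : ∀ i, φ (w i) = 1) {f : MvPolynomial σ K} {a : Λ}
    (hf : IsWeightedHomogeneous w f a) (h0 : f ≠ 0) : 0 ≤ φ a ∧ f.IsHomogeneous (φ a).toNat := by
  have key : ∀ m : σ →₀ ℕ, φ (Finsupp.weight w m) = (m.degree : ℤ) := by
    intro m
    rw [Finsupp.weight_apply, Finsupp.sum, map_sum, Finsupp.degree_apply, Nat.cast_sum]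
    refine Finset.sum_congr rfl fun i _ => ?_
    rw [map_nsmul, hφ]; simp
  obtain ⟨m, hm⟩ := ne_zero_iff.1 h0
  have h1 : φ a = (m.degree : ℤ) := by rw [← hf hm, key]
  refine ⟨by rw [h1]; positivity, ?_⟩
  intro d hd
  have h2 : φ a = (d.degree : ℤ) := by rw [← hf hd, key]
  rw [h2, Int.toNat_natCast]
  rw [Finsupp.weight_apply, Finsupp.degree_apply, Finsupp.sum]
  simp

lemma GRes.col_ne (F : GRes w J) (k : ℕ) (c : Fin (F.rank (k+1))) : ∃ r, F.diff k r c ≠ 0 := by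
  by_contra h
  push Not at h
  have h1 : F.diff k *ᵥ Pi.single c 1 = 0 := by
    funext r; simp [h]
  obtain ⟨u, hu⟩ := (F.exact_succ k _).1 h1
  have h2 := congrArg constantCoeff (congrFun hu c)
  simp [Matrix.mulVec, dotProduct, F.minimal] at h2

lemma GRes.tw_nonneg (F : GRes w J) (φ : Λ →+ ℤ) (hφ : ∀ i, φ (w i) = 1) (k : ℕ) :
    ∀ e, 0 ≤ φ (F.tw k e) := by
  induction k with
  | zero => intro e; simp [F.tw0]
  | succ k ih =>
    intro e
    obtain ⟨r, hr⟩ := F.col_ne k e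
    have := (whom_to_hom φ hφ (F.hom k r e) hr).1
    rw [map_sub] at this
    linarith [ih r]

def GRes.frozen (F : GRes w J) (φ : Λ →+ ℤ) (hφ : ∀ i, φ (w i) = 1)
    (hfin : ∃ N, ∀ i, N ≤ i → F.rank i = 0) : MinimalGradedFreeResolutionOfQuotient J where
  rank := F.rank
  twist i e := (φ (F.tw i e)).toNat
  gen _ := 1
  diff := F.diff
  gen_homog e := by rw [F.tw0]; simpa using isHomogeneous_one σ K
  gen_span g := by
    refine ⟨Pi.single ⟨0, by rw [F.rank0]; exact one_pos⟩ g, ?_⟩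
    simp
  diff_homog i r c := by
    by_cases h : F.diff i r c = 0
    · exact Or.inl h
    · right
      have := whom_to_hom φ hφ (F.hom i r c) h
      rw [map_sub] at this
      have h1 := F.tw_nonneg φ hφ i r
      have h2 := F.tw_nonneg φ hφ (i+1) c
      refine ⟨by omega, ?_⟩
      convert this.2 using 1
      omega
  minimal := F.minimal
  exact_zero v := by simpa using F.exact0 v
  exact_succ := F.exact_succ
  fin_length := hfin

theorem gor_res [Fintype σ] (hpos : ∀ m : σ →₀ ℕ, Finsupp.weight w m = 0 → m = 0)
    (hJ : ∀ f ∈ J, ∀ c, weightedHomogeneousComponent w c f ∈ J)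
    (hJ0 : ∀ f ∈ J, constantCoeff f = 0) (φ : Λ →+ ℤ) (hφ : ∀ i, φ (w i) = 1)
    (hG : QuotientIsGorenstein J) :
    ∃ (F : GRes w J) (p : ℕ), F.rank p = 1 ∧ (∀ k, p < k → F.rank k = 0) ∧
      (0 < p → ∀ x, (F.diff 0)ᵀ *ᵥ x = 0 → x = 0) ∧
      (∀ k : ℕ, k + 1 < p → ∀ c x, VHom w (fun e => - F.tw (k+1) e) c x →
        (F.diff (k+1))ᵀ *ᵥ x = 0 → ∃ y, VHom w (fun e => - F.tw k e) c y ∧ x = (F.diff k)ᵀ *ᵥ y) := by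
  obtain ⟨F⟩ := exists_GRes w hpos J hJ hJ0
  obtain ⟨q, hq, hq0, hq1⟩ := F.main hpos hJ0 hG.1
  have hfin : ∃ N, ∀ i, N ≤ i → F.rank i = 0 := ⟨q.toNat + 1, fun i hi => hq i (by omega)⟩
  have h1 := hG.2 (F.frozen φ hφ hfin)
  set p := (F.frozen φ hφ hfin).projDim with hp
  have h1 : F.rank p = 1 := h1
  have hpq : (p : ℤ) ≤ q := by
    by_contra h
    have := hq p (by omega)
    omega
  refine ⟨F, p, h1, ?_, fun h => hq0 (by omega), fun k hk => hq1 k (by omega)⟩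
  intro k hk
  by_contra h
  have : k ≤ p := by
    rw [hp]
    unfold MinimalGradedFreeResolutionOfQuotient.projDim
    refine le_csSup ⟨q.toNat, ?_⟩ h
    intro i hi
    by_contra h'
    exact hi (hq i (by omega))
  omega

end Frozen
end

noncomputable section

section Euler
open Matrix Module

lemma fr_congr {K M : Type} [Field K] [AddCommGroup M] [Module K M] {P Q : Submodule K M}
    (h : P = Q) : (finrank K P : ℤ) = finrank K Q := by rw [h]

lemma finrank_split {K M M' : Type} [Field K] [AddCommGroup M] [AddCommGroup M'] [Module K M]
    [Module K M'] (f : M →ₗ[K] M') (P : Submodule K M) [FiniteDimensional K P] :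
    finrank K P = finrank K (P.map f) + finrank K ↥(P ⊓ f.ker) := by
  have := LinearMap.finrank_range_add_finrank_ker (f.domRestrict P)
  rw [LinearMap.range_domRestrict, LinearMap.ker_domRestrict,
    ← Submodule.finrank_map_subtype_eq, Submodule.map_comap_subtype] at this
  exact this.symm

variable {σ K Λ : Type} [Field K] [AddCommGroup Λ] (w : σ → Λ) {J : Ideal (MvPolynomial σ K)}

def VS {ι : Type} (τ : ι → Λ) (c : Λ) : Submodule K (ι → MvPolynomial σ K) :=
  Submodule.pi Set.univ (fun e => weightedHomogeneousSubmodule K w (c - τ e))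

lemma mem_VS {ι : Type} {τ : ι → Λ} {c : Λ} {v : ι → MvPolynomial σ K} :
    v ∈ VS w τ c ↔ VHom w τ c v := by
  simp [VS, Submodule.mem_pi, VHom, mem_weightedHomogeneousSubmodule]

def VSequiv {ι : Type} (τ : ι → Λ) (c : Λ) : VS (K := K) w τ c ≃ₗ[K]
    ((e : ι) → weightedHomogeneousSubmodule K w (c - τ e)) where
  toFun v e := ⟨v.1 e, (mem_VS w).1 v.2 e⟩
  invFun v := ⟨fun e => (v e).1, (mem_VS w).2 fun e => (v e).2⟩
  map_add' _ _ := rfl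
  map_smul' _ _ := rfl
  left_inv _ := rfl
  right_inv _ := rfl

variable (K) in
def sd (c : Λ) : ℤ := (finrank K (weightedHomogeneousSubmodule K w c) : ℤ)

def jd (I : Ideal (MvPolynomial σ K)) (c : Λ) : ℤ :=
  (finrank K ↥(I.restrictScalars K ⊓ weightedHomogeneousSubmodule K w c) : ℤ)


lemma VS_fin (hfd : ∀ c, Module.Finite K (weightedHomogeneousSubmodule K w c))
    {ι : Type} [Fintype ι] (τ : ι → Λ) (c : Λ) : FiniteDimensional K (VS (K := K) w τ c) :=
  Module.Finite.equiv (VSequiv w τ c).symm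

lemma VS_finrank (hfd : ∀ c, Module.Finite K (weightedHomogeneousSubmodule K w c))
    {ι : Type} [Fintype ι] (τ : ι → Λ) (c : Λ) :
    (finrank K (VS (K := K) w τ c) : ℤ) = ∑ e, sd K w (c - τ e) := by
  rw [(VSequiv w τ c).finrank_eq, Module.finrank_pi_fintype]
  simp [sd]

def mv {ι κ : Type} [Fintype κ] (A : Matrix ι κ (MvPolynomial σ K)) :
    (κ → MvPolynomial σ K) →ₗ[K] (ι → MvPolynomial σ K) := A.mulVecLin.restrictScalars K

lemma alt_sum (a r : ℕ → ℤ) (h : ∀ k, a (k+1) = r k + r (k+1)) (N : ℕ) :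
    ∑ k ∈ Finset.range (N+1), (-1)^k * a k = a 0 - r 0 + (-1)^N * r N := by
  induction N with
  | zero => simp
  | succ N ih => rw [Finset.sum_range_succ, ih, h]; ring

lemma alt_sum' (a r : ℕ → ℤ) (N : ℕ) (h0 : a 0 = r 0) (h : ∀ k < N, a (k+1) = r k + r (k+1)) :
    ∑ k ∈ Finset.range (N+1), (-1)^k * a k = (-1)^N * r N := by
  induction N with
  | zero => simp [h0]
  | succ N ih =>
    rw [Finset.sum_range_succ, ih (fun k hk => h k (by omega)), h N (by omega)]; ring

def cst (K σ ι : Type) [Field K] : MvPolynomial σ K →ₗ[K] (ι → MvPolynomial σ K) :=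
  LinearMap.pi fun _ => LinearMap.id

lemma finrank_cst {ι : Type} [Nonempty ι] (P : Submodule K (MvPolynomial σ K)) :
    finrank K (P.map (cst K σ ι)) = finrank K P :=
  ((Submodule.equivMapOfInjective (cst K σ ι)
    (fun _ _ h => congrFun h (Classical.arbitrary ι)) P).finrank_eq).symm

lemma euler1 (hfd : ∀ c, Module.Finite K (weightedHomogeneousSubmodule K w c))
    (F : GRes w J) (p : ℕ) (hp : ∀ k, p < k → F.rank k = 0) (c : Λ) :
    sd K w c - jd w J c = ∑ k ∈ Finset.range (p+1), (-1)^k * ∑ e, sd K w (c - F.tw k e) := by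
  have hVS : ∀ (ι : Type) [Fintype ι] (τ : ι → Λ) (c : Λ), FiniteDimensional K (VS (K := K) w τ c) :=
    fun ι _ τ c => VS_fin w hfd τ c
  let a : ℕ → ℤ := fun k => finrank K (VS (K := K) w (F.tw k) c)
  let r : ℕ → ℤ := fun k => finrank K ((VS (K := K) w (F.tw (k+1)) c).map (mv (F.diff k)))
  have hrec : ∀ k, a (k+1) = r k + r (k+1) := by
    intro k
    simp only [a, r]
    rw [finrank_split (mv (F.diff k)) (VS w (F.tw (k+1)) c)]
    push_cast
    congr 1
    refine fr_congr ?_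
    ext v
    simp only [Submodule.mem_inf, mem_VS, Submodule.mem_map, LinearMap.mem_ker]
    constructor
    · rintro ⟨h1, h2⟩
      obtain ⟨u, hu⟩ := (F.exact_succ k v).1 h2
      refine ⟨vcomp w _ c u, vcomp_hom w _ c u, ?_⟩
      change F.diff (k+1) *ᵥ _ = _
      rw [← vcomp_mulVec w _ (F.hom (k+1)), ← hu, vcomp_same w h1]
    · rintro ⟨u, h1, rfl⟩
      exact ⟨mulVec_hom w _ (F.hom (k+1)) h1, (F.exact_succ k _).2 ⟨u, rfl⟩⟩
  have h1 := alt_sum a r hrec p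
  have hr : r p = 0 := by
    have h2 : a (p+1) = 0 := by
      simp only [a]
      rw [VS_finrank w hfd]
      have : IsEmpty (Fin (F.rank (p+1))) := by
        rw [hp (p+1) (by omega)]; infer_instance
      simp
    have h3 := hrec p
    have h4 : 0 ≤ r p := by simp [r]
    have h5 : 0 ≤ r (p+1) := by simp [r]
    omega
  rw [hr, mul_zero, add_zero] at h1
  have ha : ∀ k, a k = ∑ e, sd K w (c - F.tw k e) := fun k => VS_finrank w hfd _ _
  simp only [← ha]
  rw [h1]
  have hne : Nonempty (Fin (F.rank 0)) := by rw [F.rank0]; infer_instance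
  have hss : Subsingleton (Fin (F.rank 0)) := by rw [F.rank0]; infer_instance
  congr 1
  · rw [ha, Fintype.sum_subsingleton _ (Classical.arbitrary _), F.tw0, sub_zero]
  · simp only [r, jd]
    rw [← finrank_cst (ι := Fin (F.rank 0))]
    refine fr_congr ?_
    ext v
    simp only [Submodule.mem_map, mem_VS, Submodule.mem_inf, Submodule.restrictScalars_mem,
      mem_weightedHomogeneousSubmodule]
    set e0 := Classical.arbitrary (Fin (F.rank 0))
    have hv : ∀ v : Fin (F.rank 0) → MvPolynomial σ K, ∑ e, v e = v e0 := fun v =>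
      Fintype.sum_subsingleton _ e0
    constructor
    · rintro ⟨f, ⟨h2, h3⟩, rfl⟩
      obtain ⟨u, hu⟩ := (F.exact0 (cst K σ _ f)).1 (by rw [hv]; exact h2)
      refine ⟨vcomp w _ c u, vcomp_hom w _ c u, ?_⟩
      change F.diff 0 *ᵥ _ = _
      rw [← vcomp_mulVec w _ (F.hom 0), ← hu]
      apply vcomp_same w
      intro e
      rw [F.tw0, sub_zero]; exact h3
    · rintro ⟨u, h1, rfl⟩
      refine ⟨(F.diff 0 *ᵥ u) e0, ⟨?_, ?_⟩, ?_⟩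
      · rw [← hv (F.diff 0 *ᵥ u)]
        exact (F.exact0 _).2 ⟨u, rfl⟩
      · have := mulVec_hom w _ (F.hom 0) h1 e0
        rwa [F.tw0, sub_zero] at this
      · funext e
        rw [Subsingleton.elim e e0]; rfl

lemma euler2 (hfd : ∀ c, Module.Finite K (weightedHomogeneousSubmodule K w c))
    (F : GRes w J) (p : ℕ) (hp : ∀ k, p + 1 < k → F.rank k = 0) (hp1 : F.rank (p+1) = 1)
    (h0 : ∀ x, (F.diff 0)ᵀ *ᵥ x = 0 → x = 0)
    (hex : ∀ k : ℕ, k + 1 < p + 1 → ∀ c x, VHom w (fun e => - F.tw (k+1) e) c x →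
        (F.diff (k+1))ᵀ *ᵥ x = 0 → ∃ y, VHom w (fun e => - F.tw k e) c y ∧ x = (F.diff k)ᵀ *ᵥ y) :
    ∃ (I : Ideal (MvPolynomial σ K)) (b : Λ), J ≤ I ∧ ∀ c,
    sd K w (c + b) - jd w I (c + b) =
      (-1)^(p+1) * ∑ k ∈ Finset.range (p+2), (-1)^k * ∑ e, sd K w (c + F.tw k e) := by
  have hVS : ∀ (ι : Type) [Fintype ι] (τ : ι → Λ) (c : Λ), FiniteDimensional K (VS (K := K) w τ c) :=
    fun ι _ τ c => VS_fin w hfd τ c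
  have hne : Nonempty (Fin (F.rank (p+1))) := by rw [hp1]; infer_instance
  have hss : Subsingleton (Fin (F.rank (p+1))) := by rw [hp1]; infer_instance
  have hT : ∀ k r e, IsWeightedHomogeneous w ((F.diff k)ᵀ r e) ((- F.tw k e) - (- F.tw (k+1) r)) := by
    intro k r e
    have := F.hom k e r
    rw [Matrix.transpose_apply]
    convert this using 1
    abel
  set e0 := Classical.arbitrary (Fin (F.rank (p+1)))
  let I : Ideal (MvPolynomial σ K) := Submodule.comap
    (LinearMap.pi fun _ => LinearMap.id : MvPolynomial σ K →ₗ[MvPolynomial σ K]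
      (Fin (F.rank (p+1)) → MvPolynomial σ K)) (F.diff p)ᵀ.mulVecLin.range
  have hI : ∀ f, f ∈ I ↔ ∃ u, (F.diff p)ᵀ *ᵥ u = fun _ => f := by
    intro f
    simp only [I, Submodule.mem_comap, LinearMap.mem_range, Matrix.mulVecLin_apply]
    rfl
  refine ⟨I, F.tw (p+1) e0, ?_, ?_⟩
  · intro g hg
    obtain ⟨s, _, hs⟩ := F.homotopy hg
    have hem : IsEmpty (Fin (F.rank (p+1+1))) := by
      rw [hp (p+1+1) (by omega)]; infer_instance
    have h1 := hs p
    have h2 : F.diff (p+1) * s (p+1) = 0 := by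
      ext1 r c
      rw [Matrix.mul_apply]; simp
    rw [h2, zero_add] at h1
    rw [hI]
    refine ⟨(s p)ᵀ *ᵥ (fun _ => 1), ?_⟩
    rw [Matrix.mulVec_mulVec, ← Matrix.transpose_mul, h1]
    simp only [Matrix.transpose_smul, Matrix.transpose_one, Matrix.smul_mulVec, Matrix.one_mulVec]
    funext e
    simp
  intro c
  let a : ℕ → ℤ := fun k => finrank K (VS (K := K) w (fun e => - F.tw k e) c)
  let r : ℕ → ℤ := fun k => finrank K ((VS (K := K) w (fun e => - F.tw k e) c).map (mv (F.diff k)ᵀ))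
  have ha : ∀ k, a k = ∑ e, sd K w (c + F.tw k e) := fun k => by
    simp only [a]; rw [VS_finrank w hfd]; simp
  have hr0 : a 0 = r 0 := by
    simp only [a, r]
    rw [finrank_split (mv (F.diff 0)ᵀ)]
    have : VS (K := K) w (fun e => - F.tw 0 e) c ⊓ (mv (F.diff 0)ᵀ).ker = ⊥ := by
      rw [eq_bot_iff]
      rintro x ⟨_, hx⟩
      exact h0 x hx
    rw [this]; simp
  have hrec : ∀ k < p, a (k+1) = r k + r (k+1) := by
    intro k hk
    simp only [a, r]
    rw [finrank_split (mv (F.diff (k+1))ᵀ) (VS w _ c), add_comm]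
    push_cast
    congr 1
    refine fr_congr ?_
    ext v
    simp only [Submodule.mem_inf, mem_VS, Submodule.mem_map, LinearMap.mem_ker]
    constructor
    · rintro ⟨h1, h2⟩
      obtain ⟨y, hy, rfl⟩ := hex k (by omega) c v h1 h2
      exact ⟨y, hy, rfl⟩
    · rintro ⟨u, h1, rfl⟩
      refine ⟨mulVec_hom w _ (hT k) h1, ?_⟩
      change (F.diff (k+1))ᵀ *ᵥ ((F.diff k)ᵀ *ᵥ u) = 0
      rw [Matrix.mulVec_mulVec, ← Matrix.transpose_mul, F.sq]; simp
  have h1 := alt_sum' a r p hr0 hrec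
  simp only [← ha]
  rw [Finset.sum_range_succ, h1, mul_add, ← mul_assoc, ← mul_assoc, ← pow_add, ← pow_add]
  have e1 : (-1 : ℤ)^(p+1+p) = -1 := Odd.neg_one_pow ⟨p, by ring⟩
  have e2 : (-1 : ℤ)^(p+1+(p+1)) = 1 := Even.neg_one_pow ⟨p+1, by ring⟩
  rw [e1, e2]
  have h2 : a (p+1) = sd K w (c + F.tw (p+1) e0) := by
    rw [ha, Fintype.sum_subsingleton _ e0]
  have h3 : r p = jd w I (c + F.tw (p+1) e0) := by
    simp only [r, jd]
    rw [← finrank_cst (ι := Fin (F.rank (p+1)))]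
    refine fr_congr ?_
    ext v
    simp only [Submodule.mem_map, mem_VS, Submodule.mem_inf, Submodule.restrictScalars_mem,
      mem_weightedHomogeneousSubmodule]
    constructor
    · rintro ⟨u, h1, rfl⟩
      have h5 : ∀ e, ((F.diff p)ᵀ *ᵥ u) e = ((F.diff p)ᵀ *ᵥ u) e0 := fun e => by
        rw [Subsingleton.elim e e0]
      refine ⟨((F.diff p)ᵀ *ᵥ u) e0, ⟨?_, ?_⟩, ?_⟩
      · rw [hI]
        exact ⟨u, funext h5⟩
      · have := mulVec_hom w _ (hT p) h1 e0
        rwa [sub_neg_eq_add] at this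
      · funext e
        exact (h5 e).symm
    · rintro ⟨f, ⟨h2, h3⟩, rfl⟩
      obtain ⟨u, hu⟩ := (hI f).1 h2
      refine ⟨vcomp w _ c u, vcomp_hom w _ c u, ?_⟩
      change (F.diff p)ᵀ *ᵥ _ = _
      rw [← vcomp_mulVec w _ (hT p), hu]
      apply vcomp_same w
      intro e
      rw [sub_neg_eq_add, Subsingleton.elim e e0]; exact h3
  rw [h2, h3]; ring

end Euler
end

noncomputable section

section HilbG
open Module
variable {V K : Type} [Fintype V] [DecidableEq V] [Field K] (G : SimpleGraph V)

def wV (V : Type) [DecidableEq V] : V ⊕ V → (V → ℤ) :=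
  Sum.elim (fun v => Pi.single v 1) (fun v => Pi.single v 1)

lemma weight_wV (m : V ⊕ V →₀ ℕ) (v : V) :
    Finsupp.weight (wV V) m v = m (Sum.inl v) + m (Sum.inr v) := by
  rw [Finsupp.weight_apply, Finsupp.sum_fintype _ _ (by simp)]
  simp only [Fintype.sum_sum_type, wV, Sum.elim_inl, Sum.elim_inr, Pi.add_apply, Finset.sum_apply,
    Pi.smul_apply, Pi.single_apply]
  simp

lemma wV_pos (m : V ⊕ V →₀ ℕ) (h : Finsupp.weight (wV V) m = 0) : m = 0 := by
  ext i
  have h1 := fun v => weight_wV m v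
  rw [h] at h1
  rcases i with v | v
  · have := h1 v; simp at this ⊢; omega
  · have := h1 v; simp at this ⊢; omega

def GT (T : Finset V) : SimpleGraph V where
  Adj u v := G.Adj u v ∧ u ∈ T ∧ v ∈ T
  symm := ⟨fun _ _ h => ⟨h.1.symm, h.2.2, h.2.1⟩⟩
  loopless := ⟨fun _ h => G.irrefl h.1⟩

def cpt (T : Finset V) (v : V) : V := ((GT G T).connectedComponentMk v).out

lemma cpt_eq {T : Finset V} {u v : V} : cpt G T u = cpt G T v ↔ (GT G T).Reachable u v := by
  unfold cpt
  rw [← SimpleGraph.ConnectedComponent.eq]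
  constructor
  · intro h
    have := congrArg (Quot.mk (GT G T).Reachable) h
    have e : ∀ C : (GT G T).ConnectedComponent, Quot.mk (GT G T).Reachable (Quot.out C) = C :=
      fun C => Quot.out_eq C
    rw [e, e] at this
    exact this
  · intro h; rw [h]

def br (K : Type) [Field K] (u v : V) : MvPolynomial (V ⊕ V) K :=
  X (Sum.inl u) * X (Sum.inr v) - X (Sum.inl v) * X (Sum.inr u)

lemma br_mem {u v : V} (h : G.Adj u v) : br K u v ∈ binomialEdgeIdeal K G :=
  Ideal.subset_span ⟨u, v, h, rfl⟩

lemma br_walk (T : Finset V) {u v : V} (p : (GT G T).Walk u v) :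
    ∀ M : V ⊕ V →₀ ℕ, (∀ z ∈ T, z ≠ u → z ≠ v → 0 < M (Sum.inl z) + M (Sum.inr z)) →
      br K u v * monomial M 1 ∈ binomialEdgeIdeal K G := by
  induction p with
  | nil => intro M _; simp [br]
  | @cons u z v h p ih =>
    intro M hM
    have hg := br_mem (K := K) G h.1
    by_cases hzv : z = v
    · subst hzv
      exact Ideal.mul_mem_right _ _ hg
    have hzu : z ≠ u := fun e => G.irrefl (e ▸ h.1)
    have hz := hM z h.2.2 hzu hzv
    have key : ∀ (a : V → V ⊕ V), (∀ t s, a t = a s → t = s) → (a = Sum.inl ∨ a = Sum.inr) →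
        0 < M (a z) → (X (a z) * br K u v = X (a u) * br K z v + X (a v) * br K u z) →
        br K u v * monomial M 1 ∈ binomialEdgeIdeal K G := by
      intro a ha ha' hpos hid
      have e1 : M = Finsupp.single (a z) 1 + (M - Finsupp.single (a z) 1) := by
        rw [add_comm, tsub_add_cancel_of_le]
        exact Finsupp.single_le_iff.2 hpos
      set M' := M - Finsupp.single (a z) 1
      have e2 : (monomial M 1 : MvPolynomial (V ⊕ V) K) = X (a z) * monomial M' 1 := by
        rw [X, monomial_mul, ← e1, mul_one]
      rw [e2]
      have e3 : br K u v * (X (a z) * monomial M' 1) =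
          br K z v * (X (a u) * monomial M' 1) + br K u z * (X (a v) * monomial M' 1) := by
        linear_combination (monomial M' 1) * hid
      rw [e3]
      refine Ideal.add_mem _ ?_ (Ideal.mul_mem_right _ _ hg)
      have e4 : X (a u) * monomial M' 1 =
          (monomial (Finsupp.single (a u) 1 + M') 1 : MvPolynomial (V ⊕ V) K) := by
        rw [X, monomial_mul, mul_one]
      rw [e4]
      apply ih
      intro y hy hyz hyv
      by_cases hyu : y = u
      · subst hyu
        rcases ha' with rfl | rfl <;> simp <;> omega
      · have h3 := hM y hy hyu hyv
        rw [e1] at h3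
        rcases ha' with rfl | rfl <;> simp [Ne.symm hyz] at h3 ⊢ <;> omega
    rcases Nat.eq_zero_or_pos (M (Sum.inl z)) with h0 | h0
    · exact key Sum.inr (fun _ _ => Sum.inr_injective.eq_iff.1) (Or.inr rfl) (by omega)
        (by simp only [br]; ring)
    · exact key Sum.inl (fun _ _ => Sum.inl_injective.eq_iff.1) (Or.inl rfl) h0
        (by simp only [br]; ring)

lemma token (T : Finset V) (N : ℕ) : ∀ m m' : V ⊕ V →₀ ℕ,
    (∀ v, m (Sum.inl v) + m (Sum.inr v) = m' (Sum.inl v) + m' (Sum.inr v)) →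
    (∀ v ∈ T, 0 < m (Sum.inl v) + m (Sum.inr v)) →
    (∀ r, ∑ v with cpt G T v = r, m (Sum.inl v) = ∑ v with cpt G T v = r, m' (Sum.inl v)) →
    ∑ v, ((m (Sum.inl v) : ℤ) - m' (Sum.inl v)).natAbs ≤ N →
    (monomial m 1 - monomial m' 1 : MvPolynomial (V ⊕ V) K) ∈ binomialEdgeIdeal K G := by
  induction N with
  | zero =>
    intro m m' hw _ _ h0
    have h1 : ∀ v, m (Sum.inl v) = m' (Sum.inl v) := by
      intro v
      have := (Finset.sum_eq_zero_iff.1 (Nat.le_zero.1 h0)) v (Finset.mem_univ v)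
      omega
    have : m = m' := by
      ext i
      rcases i with v | v
      · exact h1 v
      · have := hw v; have := h1 v; omega
    rw [this]; simp
  | succ N ih =>
    intro m m' hw hT hr hN
    by_cases h1 : ∀ v, m (Sum.inl v) = m' (Sum.inl v)
    · have : m = m' := by
        ext i
        rcases i with v | v
        · exact h1 v
        · have := hw v; have := h1 v; omega
      rw [this]; simp
    have h2 : ∃ v, m' (Sum.inl v) < m (Sum.inl v) := by
      by_contra h
      push Not at h h1
      obtain ⟨v, hv⟩ := h1
      have := hr (cpt G T v)
      have h3 : ∑ v' with cpt G T v' = cpt G T v, m (Sum.inl v') <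
          ∑ v' with cpt G T v' = cpt G T v, m' (Sum.inl v') :=
        Finset.sum_lt_sum (fun i _ => h i) ⟨v, by simp, lt_of_le_of_ne (h v) hv⟩
      omega
    obtain ⟨v, hv⟩ := h2
    have h3 : ∃ u, cpt G T u = cpt G T v ∧ m (Sum.inl u) < m' (Sum.inl u) := by
      by_contra h
      push Not at h
      have := hr (cpt G T v)
      have h3 : ∑ v' with cpt G T v' = cpt G T v, m' (Sum.inl v') <
          ∑ v' with cpt G T v' = cpt G T v, m (Sum.inl v') :=
        Finset.sum_lt_sum (fun i hi => h i (by simpa using hi)) ⟨v, by simp, hv⟩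
      omega
    obtain ⟨u, huv, hu⟩ := h3
    have hne : u ≠ v := by rintro rfl; omega
    obtain ⟨p⟩ := (cpt_eq G).1 huv.symm
    have hwu := hw u
    have hle : Finsupp.single (Sum.inl v) 1 + Finsupp.single (Sum.inr u) 1 ≤ m := by
      intro i
      rcases i with i | i
      · simp [Finsupp.single_apply]; split_ifs with h
        · subst h; omega
        · omega
      · simp [Finsupp.single_apply]; split_ifs with h
        · subst h; omega
        · omega
    set M := m - (Finsupp.single (Sum.inl v) 1 + Finsupp.single (Sum.inr u) 1)
    have hm : m = Finsupp.single (Sum.inl v) 1 + Finsupp.single (Sum.inr u) 1 + M := by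
      rw [add_comm, tsub_add_cancel_of_le hle]
    set m1 := Finsupp.single (Sum.inl u) 1 + Finsupp.single (Sum.inr v) 1 + M with hm1
    have hb := br_walk (K := K) G T p M (by
      intro z hz hzv hzu
      have := hT z hz
      rw [hm] at this
      simpa [Ne.symm hzv, Ne.symm hzu] using this)
    have hd : br K v u * monomial M 1 = (monomial m 1 - monomial m1 1 : MvPolynomial (V ⊕ V) K) := by
      rw [hm, hm1, br, sub_mul]
      simp only [X, monomial_mul, mul_one]
    rw [hd] at hb
    have hl : ∀ z, m1 (Sum.inl z) + (if z = v then 1 else 0) = m (Sum.inl z) + (if z = u then 1 else 0) := by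
      intro z
      rw [hm, hm1]
      simp only [Finsupp.add_apply, Finsupp.single_apply, Sum.inl.injEq, reduceCtorEq, if_false,
        eq_comm (a := z)]
      omega
    have hrr : ∀ z, m1 (Sum.inr z) + (if z = u then 1 else 0) = m (Sum.inr z) + (if z = v then 1 else 0) := by
      intro z
      rw [hm, hm1]
      simp only [Finsupp.add_apply, Finsupp.single_apply, Sum.inr.injEq, reduceCtorEq, if_false,
        eq_comm (a := z)]
      omega
    have h4 := ih m1 m' (by
      intro z; have := hl z; have := hrr z; have := hw z; omega) (by
      intro z hz; have := hl z; have := hrr z; have := hT z hz; omega) (by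
      intro r
      rw [← hr r]
      have := Finset.sum_congr (s₁ := Finset.univ.filter fun v => cpt G T v = r) rfl fun z _ => hl z
      rw [Finset.sum_add_distrib, Finset.sum_add_distrib] at this
      have e1 : (∑ z with cpt G T z = r, if z = v then 1 else 0) =
        ∑ z with cpt G T z = r, if z = u then 1 else 0 := by
        rw [Finset.sum_ite_eq', Finset.sum_ite_eq']
        simp [huv]
      omega) (by
      have h5 : ∑ z, ((m1 (Sum.inl z) : ℤ) - m' (Sum.inl z)).natAbs <
          ∑ z, ((m (Sum.inl z) : ℤ) - m' (Sum.inl z)).natAbs := by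
        apply Finset.sum_lt_sum
        · intro z _
          have h6 := hl z
          by_cases hzv : z = v
          · subst hzv; simp [Ne.symm hne] at h6; omega
          · by_cases hzu : z = u
            · subst hzu; simp [hzv] at h6; omega
            · simp [hzv, hzu] at h6; omega
        · refine ⟨v, Finset.mem_univ _, ?_⟩
          have h6 := hl v
          simp [Ne.symm hne] at h6; omega
      omega)
    have := Ideal.add_mem _ hb h4
    rwa [sub_add_sub_cancel] at this

end HilbG
end

noncomputable section

section HilbH
open Module
variable {V K : Type} [Fintype V] [DecidableEq V] [Field K] (G : SimpleGraph V)

def spn (K : Type) [Field K] {τ : Type} (P : Set (τ →₀ ℕ)) : Submodule K (MvPolynomial τ K) :=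
  Submodule.span K ((fun m => monomial m 1) '' P)

lemma spn_range {τ : Type} (P : Set (τ →₀ ℕ)) :
    spn K P = Submodule.span K (Set.range fun m : P => (monomial m.1 1 : MvPolynomial τ K)) := by
  rw [spn, Set.image_eq_range]

lemma finrank_spn {τ : Type} (P : Set (τ →₀ ℕ)) [Finite P] : finrank K (spn K P) = Nat.card P := by
  have := Fintype.ofFinite P
  rw [spn_range, finrank_span_eq_card, Nat.card_eq_fintype_card]
  have h := (basisMonomials τ K).linearIndependent.comp (fun m : P => m.1) Subtype.val_injective
  simpa [Function.comp_def] using h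

lemma fin_spn {τ : Type} (P : Set (τ →₀ ℕ)) [Finite P] : Module.Finite K (spn K P) := by
  rw [spn_range]
  exact FiniteDimensional.span_of_finite K (Set.finite_range _)

lemma whs_spn {τ Λ : Type} [AddCommGroup Λ] (w : τ → Λ) (c : Λ) :
    weightedHomogeneousSubmodule K w c = spn K {m | Finsupp.weight w m = c} := by
  apply le_antisymm
  · intro f hf
    rw [f.as_sum]
    refine Submodule.sum_mem _ fun m hm => ?_
    have : (monomial m (coeff m f) : MvPolynomial τ K) = coeff m f • monomial m 1 := by
      rw [smul_monomial, smul_eq_mul, mul_one]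
    rw [this]
    exact Submodule.smul_mem _ _ (Submodule.subset_span ⟨m, hf (mem_support_iff.1 hm), rfl⟩)
  · rw [spn, Submodule.span_le]
    rintro _ ⟨m, hm, rfl⟩
    exact isWeightedHomogeneous_monomial _ _ _ hm

def degEquiv (c : V → ℕ) : {m : V ⊕ V →₀ ℕ | Finsupp.weight (wV V) m = fun v => (c v : ℤ)} ≃
    ((v : V) → Fin (c v + 1)) where
  toFun m v := ⟨m.1 (Sum.inl v), by
    have := congrFun m.2 v
    rw [weight_wV] at this
    omega⟩
  invFun f := ⟨Finsupp.equivFunOnFinite.symm (Sum.elim (fun v => (f v).1) (fun v => c v - (f v).1)), by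
    funext v
    rw [weight_wV]
    have := (f v).2
    simp
    omega⟩
  left_inv m := by
    ext i
    have h := fun v => congrFun m.2 v
    simp only [weight_wV] at h
    rcases i with v | v
    · rfl
    · have := h v
      simp
      omega
  right_inv f := by
    funext v; ext; rfl

def boxEquiv (y : V → ℕ) : {m : V →₀ ℕ | ∀ r, m r ≤ y r} ≃ ((v : V) → Fin (y v + 1)) where
  toFun m v := ⟨m.1 v, Nat.lt_succ_of_le (m.2 v)⟩
  invFun f := ⟨Finsupp.equivFunOnFinite.symm (fun v => (f v).1), fun v => Nat.le_of_lt_succ (f v).2⟩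
  left_inv m := by ext; rfl
  right_inv f := by funext v; ext; rfl

lemma deg_neg {c : V → ℤ} (h : ∃ v, c v < 0) : {m : V ⊕ V →₀ ℕ | Finsupp.weight (wV V) m = c} = ∅ := by
  ext m
  simp only [Set.mem_ofPred_eq, Set.mem_empty_iff_false, iff_false]
  rintro rfl
  obtain ⟨v, hv⟩ := h
  rw [weight_wV] at hv
  omega

lemma nonneg_cast {c : V → ℤ} (h : ¬ ∃ v, c v < 0) : ∃ c' : V → ℕ, c = fun v => (c' v : ℤ) := by
  push Not at h
  exact ⟨fun v => (c v).toNat, funext fun v => by simp [h v]⟩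

lemma fin_deg (c : V → ℤ) : Finite {m : V ⊕ V →₀ ℕ | Finsupp.weight (wV V) m = c} := by
  by_cases h : ∃ v, c v < 0
  · rw [deg_neg h]; infer_instance
  · obtain ⟨c', rfl⟩ := nonneg_cast h
    exact Finite.of_equiv _ (degEquiv c').symm

lemma wV_fd (c : V → ℤ) : Module.Finite K (weightedHomogeneousSubmodule K (wV V) c) := by
  rw [whs_spn]
  have := fin_deg c
  exact fin_spn _

def s1 (a : ℤ) : ℤ := if 0 ≤ a then a + 1 else 0

lemma sd_eq (c : V → ℤ) : sd K (wV V) c = ∏ v, s1 (c v) := by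
  unfold sd
  rw [whs_spn]
  have := fin_deg c
  rw [finrank_spn]
  by_cases h : ∃ v, c v < 0
  · rw [deg_neg h]
    obtain ⟨v, hv⟩ := h
    rw [Finset.prod_eq_zero (Finset.mem_univ v) (by simp [s1, hv])]
    simp
  · obtain ⟨c', rfl⟩ := nonneg_cast h
    rw [Nat.card_congr (degEquiv c')]
    simp [s1]

lemma J_const (f : MvPolynomial (V ⊕ V) K) (hf : f ∈ binomialEdgeIdeal K G) : constantCoeff f = 0 := by
  have : binomialEdgeIdeal K G ≤ RingHom.ker (constantCoeff (σ := V ⊕ V) (R := K)) := by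
    unfold binomialEdgeIdeal
    rw [Ideal.span_le]
    rintro _ ⟨i, j, _, rfl⟩
    simp [RingHom.mem_ker]
  exact this hf

lemma br_hom (i j : V) : IsWeightedHomogeneous (wV V) (br K i j) (Pi.single i 1 + Pi.single j 1) := by
  unfold br
  refine (weightedHomogeneousSubmodule K (wV V) _).sub_mem ?_ ?_
  · exact (isWeightedHomogeneous_X K (wV V) (Sum.inl i)).mul (isWeightedHomogeneous_X K (wV V) (Sum.inr j))
  · rw [add_comm]
    exact (isWeightedHomogeneous_X K (wV V) (Sum.inl j)).mul (isWeightedHomogeneous_X K (wV V) (Sum.inr i))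

lemma J_graded (f : MvPolynomial (V ⊕ V) K) (hf : f ∈ binomialEdgeIdeal K G) :
    ∀ c, weightedHomogeneousComponent (wV V) c f ∈ binomialEdgeIdeal K G := by
  intro c
  unfold binomialEdgeIdeal at hf
  induction hf using Submodule.span_induction generalizing c with
  | mem x h =>
    obtain ⟨i, j, hij, rfl⟩ := h
    have h1 := whc_mul (wV V) (br_hom (K := K) i j) c 1
    rw [mul_one] at h1
    rw [← br, h1]
    exact Ideal.mul_mem_right _ _ (br_mem G hij)
  | zero => simp
  | add x y _ _ hx hy => rw [map_add]; exact Ideal.add_mem _ (hx c) (hy c)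
  | smul a x hx ih =>
    obtain ⟨s, hs⟩ := exists_vsum (wV V) (fun _ : Unit => (0 : V → ℤ)) (fun _ => a)
    have ha := congrFun hs ()
    rw [Finset.sum_apply] at ha
    rw [smul_eq_mul, ha, Finset.sum_mul, map_sum]
    refine Ideal.sum_mem _ fun d _ => ?_
    rw [whc_mul (wV V) (vcomp_hom (wV V) _ d _ ())]
    exact Ideal.mul_mem_left _ _ (ih _)

def PiG (T : Finset V) (x : V → ℤ) : ℤ := ∏ r, (1 + ∑ v with cpt G T v = r, x v)

def Psi (K : Type) [Field K] (T : Finset V) : MvPolynomial (V ⊕ V) K →ₐ[K] MvPolynomial V K :=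
  aeval (Sum.elim (fun v => if v ∈ T then X (cpt G T v) else 0) (fun v => if v ∈ T then 1 else 0))

lemma Psi_J (T : Finset V) (f : MvPolynomial (V ⊕ V) K) (hf : f ∈ binomialEdgeIdeal K G) :
    Psi G K T f = 0 := by
  have : binomialEdgeIdeal K G ≤ RingHom.ker (Psi G K T) := by
    unfold binomialEdgeIdeal
    rw [Ideal.span_le]
    rintro _ ⟨i, j, hij, rfl⟩
    simp only [SetLike.mem_coe, RingHom.mem_ker, Psi, map_sub, map_mul, aeval_X, Sum.elim_inl, Sum.elim_inr]
    by_cases hi : i ∈ T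
    · by_cases hj : j ∈ T
      · have : cpt G T i = cpt G T j :=
          (cpt_eq G).2 (SimpleGraph.Adj.reachable (G := GT G T) ⟨hij, hi, hj⟩)
        simp [hi, hj, this]
      · simp [hi, hj]
    · simp [hi]
  exact this hf

def kap (T : Finset V) (m : V ⊕ V →₀ ℕ) : V →₀ ℕ :=
  Finsupp.equivFunOnFinite.symm fun r => ∑ v with cpt G T v = r, m (Sum.inl v)

lemma Psi_mon (T : Finset V) (m : V ⊕ V →₀ ℕ) (hm : ∀ v, v ∉ T → m (Sum.inl v) = 0 ∧ m (Sum.inr v) = 0) :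
    Psi G K T (monomial m 1) = monomial (kap G T m) 1 := by
  rw [Psi, aeval_monomial, map_one, one_mul, Finsupp.prod_fintype _ _ (by simp), Fintype.prod_sum_type]
  simp only [Sum.elim_inl, Sum.elim_inr]
  have h2 : ∏ x, (if x ∈ T then (1 : MvPolynomial V K) else 0) ^ m (Sum.inr x) = 1 := by
    refine Finset.prod_eq_one fun v _ => ?_
    by_cases h : v ∈ T
    · simp [h]
    · simp [h, hm v h]
  rw [h2, mul_one]
  have h3 : ∀ x, (if x ∈ T then (X (cpt G T x) : MvPolynomial V K) else 0) ^ m (Sum.inl x) =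
      monomial (Finsupp.single (cpt G T x) (m (Sum.inl x))) 1 := by
    intro v
    by_cases h : v ∈ T
    · simp [h, X_pow_eq_monomial]
    · simp [h, hm v h]
  simp only [h3]
  rw [← monomial_sum_one]
  congr 1
  congr 1
  ext r
  simp only [Finsupp.finset_sum_apply, kap, Finsupp.equivFunOnFinite_symm_apply_apply, Finsupp.single_apply]
  rw [Finset.sum_filter]

lemma exists_sub (s : Finset V) (x : V → ℕ) : ∀ g, g ≤ ∑ v ∈ s, x v → ∃ f : V → ℕ, (∀ v, f v ≤ x v) ∧
    ∑ v ∈ s, f v = g := by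
  induction s using Finset.induction_on with
  | empty => intro g hg; exact ⟨0, fun _ => Nat.zero_le _, by simp at hg; simp [hg]⟩
  | insert a s ha ih =>
    intro g hg
    rw [Finset.sum_insert ha] at hg
    obtain ⟨f, hf, hs⟩ := ih (g - min g (x a)) (by omega)
    refine ⟨Function.update f a (min g (x a)), ?_, ?_⟩
    · intro v
      by_cases h : v = a
      · subst h; simp
      · simp [h, hf v]
    · rw [Finset.sum_insert ha, Function.update_self, Finset.sum_congr rfl (g := f), hs]
      · omega
      · intro v hv
        rw [Function.update_of_ne]
        rintro rfl; exact ha hv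

lemma kap_image (T : Finset V) (x : V → ℕ) :
    kap G T '' {m | Finsupp.weight (wV V) m = fun v => (x v : ℤ)} =
      {μ : V →₀ ℕ | ∀ r, μ r ≤ ∑ v with cpt G T v = r, x v} := by
  ext μ
  constructor
  · rintro ⟨m, hm, rfl⟩ r
    simp only [kap, Finsupp.equivFunOnFinite_symm_apply_apply]
    refine Finset.sum_le_sum fun v _ => ?_
    have := congrFun hm v
    rw [weight_wV] at this
    omega
  · intro h
    choose f hf hs using fun r => exists_sub (Finset.univ.filter fun v => cpt G T v = r) x (μ r) (h r)
    refine ⟨Finsupp.equivFunOnFinite.symm (Sum.elim (fun v => f (cpt G T v) v)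
      (fun v => x v - f (cpt G T v) v)), ?_, ?_⟩
    · funext v
      rw [weight_wV]
      have := hf (cpt G T v) v
      simp
      omega
    · ext r
      simp only [kap, Finsupp.equivFunOnFinite_symm_apply_apply, Sum.elim_inl]
      rw [← hs r]
      refine Finset.sum_congr rfl fun v hv => ?_
      simp at hv
      rw [hv]

lemma hil_nat (x : V → ℕ) : sd K (wV V) (fun v => (x v : ℤ)) - jd (wV V) (binomialEdgeIdeal K G) (fun v => (x v : ℤ))
    = PiG G (Finset.univ.filter fun v => 0 < x v) (fun v => (x v : ℤ)) := by
  set T := Finset.univ.filter fun v => 0 < x v with hT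
  set c : V → ℤ := fun v => (x v : ℤ) with hc
  have hfd := wV_fd (K := K) c
  have hm0 : ∀ m : V ⊕ V →₀ ℕ, Finsupp.weight (wV V) m = c →
      ∀ v, v ∉ T → m (Sum.inl v) = 0 ∧ m (Sum.inr v) = 0 := by
    intro m hm v hv
    have := congrFun hm v
    rw [weight_wV] at this
    simp [hT] at hv
    simp only [hc] at this
    omega
  have hsplit := finrank_split (Psi G K T).toLinearMap (weightedHomogeneousSubmodule K (wV V) c)
  have h1 : (weightedHomogeneousSubmodule K (wV V) c).map (Psi G K T).toLinearMap =
      spn K {μ : V →₀ ℕ | ∀ r, μ r ≤ ∑ v with cpt G T v = r, x v} := by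
    rw [whs_spn, spn, Submodule.map_span, Set.image_image, ← kap_image, spn, Set.image_image]
    congr 1
    refine Set.image_congr fun m hm => ?_
    exact Psi_mon G T m (hm0 m hm)
  have h2 : weightedHomogeneousSubmodule K (wV V) c ⊓ (Psi G K T).toLinearMap.ker =
      (binomialEdgeIdeal K G).restrictScalars K ⊓ weightedHomogeneousSubmodule K (wV V) c := by
    rw [inf_comm]
    ext f
    simp only [Submodule.mem_inf, Submodule.restrictScalars_mem, LinearMap.mem_ker]
    refine ⟨fun ⟨h3, h4⟩ => ⟨?_, h4⟩, fun ⟨h3, h4⟩ => ⟨Psi_J G T f h3, h4⟩⟩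
    classical
    let rep : (V →₀ ℕ) → (V ⊕ V →₀ ℕ) := fun μ =>
      if h : ∃ m, Finsupp.weight (wV V) m = c ∧ kap G T m = μ then h.choose else 0
    let Lr : MvPolynomial V K →ₗ[K] MvPolynomial (V ⊕ V) K :=
      (basisMonomials V K).constr K fun μ => monomial (rep μ) 1
    have key : ∀ g ∈ weightedHomogeneousSubmodule K (wV V) c,
        g - Lr (Psi G K T g) ∈ (binomialEdgeIdeal K G).restrictScalars K := by
      intro g hg
      rw [whs_spn, spn] at hg
      induction hg using Submodule.span_induction with
      | mem g hg =>
        obtain ⟨m, hm, rfl⟩ := hg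
        simp only
        rw [Psi_mon G T m (hm0 m hm)]
        have e1 : Lr (monomial (kap G T m) 1) = monomial (rep (kap G T m)) 1 := by
          have := (basisMonomials V K).constr_basis K (fun μ => (monomial (rep μ) 1 : MvPolynomial (V ⊕ V) K)) (kap G T m)
          simpa using this
        rw [e1]
        have hex : ∃ m', Finsupp.weight (wV V) m' = c ∧ kap G T m' = kap G T m := ⟨m, hm, rfl⟩
        have e2 : rep (kap G T m) = hex.choose := by simp only [rep]; rw [dif_pos hex]
        rw [e2]
        obtain ⟨h5, h6⟩ := hex.choose_spec
        refine token G T _ m _ ?_ ?_ ?_ le_rfl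
        · intro v
          have e3 := congrFun h5 v
          have e4 := congrFun hm v
          rw [weight_wV] at e3 e4
          omega
        · intro v hv
          have e4 := congrFun hm v
          rw [weight_wV] at e4
          simp [hT] at hv
          simp only [hc] at e4
          omega
        · intro r
          have := DFunLike.congr_fun h6 r
          simpa [kap] using this.symm
      | zero => simp
      | add a b _ _ ha hb =>
        have := Submodule.add_mem _ ha hb
        simp only [map_add]
        convert this using 1
        abel
      | smul a b _ hb =>
        have := Submodule.smul_mem _ a hb
        simpa [smul_sub] using this
    have := key f h4
    have h3' : Psi G K T f = 0 := h3
    rw [h3', map_zero, sub_zero] at this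
    exact this
  rw [h1, h2] at hsplit
  have hfin : Finite {μ : V →₀ ℕ | ∀ r, μ r ≤ ∑ v with cpt G T v = r, x v} :=
    Finite.of_equiv _ (boxEquiv _).symm
  rw [finrank_spn, Nat.card_congr (boxEquiv _)] at hsplit
  unfold sd jd
  rw [hsplit]
  unfold PiG
  simp [hc, add_comm]

lemma hil (x : V → ℤ) (hx : ∀ v, 0 ≤ x v) : sd K (wV V) x - jd (wV V) (binomialEdgeIdeal K G) x
    = PiG G (Finset.univ.filter fun v => 0 < x v) x := by
  obtain ⟨x', rfl⟩ := nonneg_cast (c := x) (by push Not; exact hx)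
  rw [hil_nat]
  congr 1
  ext v; simp

lemma hil_neg (x : V → ℤ) (hx : ∃ v, x v < 0) :
    sd K (wV V) x - jd (wV V) (binomialEdgeIdeal K G) x = 0 := by
  have : sd K (wV V) x = 0 := by
    rw [sd_eq]
    obtain ⟨v, hv⟩ := hx
    exact Finset.prod_eq_zero (Finset.mem_univ v) (by simp [s1, hv])
  have h2 : jd (wV V) (binomialEdgeIdeal K G) x ≤ sd K (wV V) x := by
    have := wV_fd (K := K) x
    unfold jd sd
    exact_mod_cast Submodule.finrank_mono inf_le_right
  have h3 : 0 ≤ jd (wV V) (binomialEdgeIdeal K G) x := by simp [jd]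
  omega

end HilbH
end

noncomputable section

section Numeric
variable {V E : Type} [Fintype V] [DecidableEq V] [Fintype E] (G : SimpleGraph V)
  (ε : E → ℤ) (τ : E → V → ℤ)

def HU (U : Finset V) (x : V → ℤ) : ℤ :=
  ∑ i, ε i * ((∏ v ∈ U, (x v - τ i v + 1)) * ∏ v ∈ Finset.univ \ U, s1 (x v - τ i v))

def hS (x : V → ℤ) : ℤ := ∑ i, ε i * ∏ v, s1 (x v - τ i v)

def gS (c : V → ℤ) : ℤ := ∑ i, ε i * ∏ v, s1 (c v - 2 + τ i v)

lemma s1_dual (y : ℤ) : s1 (-y - 2) = -(y + 1) + s1 y := by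
  unfold s1; split_ifs <;> omega

lemma gS_eq (c : V → ℤ) : gS ε τ c = ∑ U ∈ (Finset.univ : Finset V).powerset, (-1) ^ U.card * HU ε τ U (-c) := by
  unfold gS HU
  simp only [Finset.mul_sum]
  rw [Finset.sum_comm]
  refine Finset.sum_congr rfl fun i _ => ?_
  have : ∀ v, s1 (c v - 2 + τ i v) = -((-c) v - τ i v + 1) + s1 ((-c) v - τ i v) := by
    intro v
    rw [← s1_dual]; congr 1; simp; ring
  simp only [this]
  rw [Finset.prod_add, Finset.mul_sum]
  refine Finset.sum_congr rfl fun U _ => ?_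
  rw [Finset.prod_neg]
  ring

lemma HU_eq (hh : ∀ x : V → ℤ, (∀ v, 0 ≤ x v) → hS ε τ x = PiG G (Finset.univ.filter fun v => 0 < x v) x)
    (U : Finset V) (x : V → ℤ) (hx : ∀ v, v ∉ U → 0 ≤ x v) :
    HU ε τ U x = PiG G (U ∪ Finset.univ.filter fun v => 0 < x v) x := by
  set T := U ∪ Finset.univ.filter fun v => 0 < x v with hT
  let y : ℤ → V → ℤ := fun t v => x v + if v ∈ U then t else 0
  let P1 : Polynomial ℤ := ∑ i, Polynomial.C (ε i) * ((∏ v ∈ U, (Polynomial.C (x v - τ i v + 1) + Polynomial.X)) *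
    Polynomial.C (∏ v ∈ Finset.univ \ U, s1 (x v - τ i v)))
  let P2 : Polynomial ℤ := ∏ r, (1 + ∑ v with cpt G T v = r, (Polynomial.C (x v) + if v ∈ U then Polynomial.X else 0))
  have e1 : ∀ t, P1.eval t = HU ε τ U (y t) := by
    intro t
    simp only [P1, HU, Polynomial.eval_finsetSum, Polynomial.eval_mul, Polynomial.eval_prod, Polynomial.eval_add, Polynomial.eval_C, Polynomial.eval_X]
    refine Finset.sum_congr rfl fun i _ => ?_
    congr 2
    · refine Finset.prod_congr rfl fun v hv => ?_
      simp [y, hv]; ring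
    · refine Finset.prod_congr rfl fun v hv => ?_
      simp at hv
      simp [y, hv]
  have e2 : ∀ t, P2.eval t = PiG G T (y t) := by
    intro t
    simp only [P2, PiG, Polynomial.eval_prod, Polynomial.eval_add, Polynomial.eval_one, Polynomial.eval_finsetSum, Polynomial.eval_C, y]
    refine Finset.prod_congr rfl fun r _ => ?_
    congr 1
    refine Finset.sum_congr rfl fun v _ => ?_
    split_ifs <;> simp
  have y0 : y 0 = x := by funext v; simp [y]
  have key : P1 = P2 := by
    refine Polynomial.eq_of_infinite_eval_eq _ _ ?_
    let N : ℤ := 1 + ∑ v, |x v| + ∑ i, ∑ v, |τ i v|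
    have hN : ∀ v i, |x v| + |τ i v| + 1 ≤ N := by
      intro v i
      have h1 := Finset.single_le_sum (f := fun v => |x v|) (fun _ _ => abs_nonneg _) (Finset.mem_univ v)
      have h2 := Finset.single_le_sum (f := fun v => |τ i v|) (fun _ _ => abs_nonneg _) (Finset.mem_univ v)
      have h3 := Finset.single_le_sum (f := fun i => ∑ v, |τ i v|)
        (fun _ _ => Finset.sum_nonneg fun _ _ => abs_nonneg _) (Finset.mem_univ i)
      simp only [N]
      linarith
    have hN' : ∀ v, |x v| + 1 ≤ N := by
      intro v
      have h1 := Finset.single_le_sum (f := fun v => |x v|) (fun _ _ => abs_nonneg _) (Finset.mem_univ v)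
      have h3 : 0 ≤ ∑ i, ∑ v, |τ i v| := Finset.sum_nonneg fun _ _ => Finset.sum_nonneg fun _ _ => abs_nonneg _
      simp only [N]
      linarith
    refine (Set.Ici_infinite N).mono ?_
    intro t ht
    have ht : N ≤ t := ht
    change P1.eval t = P2.eval t
    rw [e1, e2]
    have h3 : HU ε τ U (y t) = hS ε τ (y t) := by
      unfold HU hS
      refine Finset.sum_congr rfl fun i _ => ?_
      congr 1
      rw [← Finset.prod_sdiff (Finset.subset_univ U), mul_comm]
      congr 1
      refine Finset.prod_congr rfl fun v hv => ?_
      have h4 := hN v i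
      have h5 : 0 ≤ y t v - τ i v := by
        simp only [y, hv, if_true]
        have := neg_abs_le (x v)
        have := le_abs_self (τ i v)
        linarith
      rw [s1, if_pos h5]
    rw [h3, hh]
    · congr 1
      ext v
      simp only [Finset.mem_filter, Finset.mem_univ, true_and, hT, Finset.mem_union, y]
      by_cases hv : v ∈ U
      · simp [hv]
        have h4 := hN' v
        have := neg_abs_le (x v)
        linarith
      · simp [hv]
    · intro v
      by_cases hv : v ∈ U
      · simp [y, hv]
        have h4 := hN' v
        have := neg_abs_le (x v)
        linarith
      · simpa [y, hv] using hx v hv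
  have := congrArg (Polynomial.eval 0) key
  rwa [e1, e2, y0] at this

lemma HU_zero (hn : ∀ x : V → ℤ, (∃ v, x v < 0) → hS ε τ x = 0)
    (U : Finset V) (x : V → ℤ) (hx : ∃ v, v ∉ U ∧ x v < 0) : HU ε τ U x = 0 := by
  let y : ℤ → V → ℤ := fun t v => x v + if v ∈ U then t else 0
  let P1 : Polynomial ℤ := ∑ i, Polynomial.C (ε i) * ((∏ v ∈ U, (Polynomial.C (x v - τ i v + 1) + Polynomial.X)) *
    Polynomial.C (∏ v ∈ Finset.univ \ U, s1 (x v - τ i v)))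
  have e1 : ∀ t, P1.eval t = HU ε τ U (y t) := by
    intro t
    simp only [P1, HU, Polynomial.eval_finsetSum, Polynomial.eval_mul, Polynomial.eval_prod, Polynomial.eval_add, Polynomial.eval_C, Polynomial.eval_X]
    refine Finset.sum_congr rfl fun i _ => ?_
    congr 2
    · refine Finset.prod_congr rfl fun v hv => ?_
      simp [y, hv]; ring
    · refine Finset.prod_congr rfl fun v hv => ?_
      simp at hv
      simp [y, hv]
  have y0 : y 0 = x := by funext v; simp [y]
  have key : P1 = 0 := by
    refine Polynomial.eq_of_infinite_eval_eq _ _ ?_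
    let N : ℤ := 1 + ∑ v, |x v| + ∑ i, ∑ v, |τ i v|
    have hN : ∀ v i, |x v| + |τ i v| + 1 ≤ N := by
      intro v i
      have h1 := Finset.single_le_sum (f := fun v => |x v|) (fun _ _ => abs_nonneg _) (Finset.mem_univ v)
      have h2 := Finset.single_le_sum (f := fun v => |τ i v|) (fun _ _ => abs_nonneg _) (Finset.mem_univ v)
      have h3 := Finset.single_le_sum (f := fun i => ∑ v, |τ i v|)
        (fun _ _ => Finset.sum_nonneg fun _ _ => abs_nonneg _) (Finset.mem_univ i)
      simp only [N]
      linarith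
    refine (Set.Ici_infinite N).mono ?_
    intro t ht
    have ht : N ≤ t := ht
    change P1.eval t = Polynomial.eval t 0
    rw [e1, Polynomial.eval_zero]
    have h3 : HU ε τ U (y t) = hS ε τ (y t) := by
      unfold HU hS
      refine Finset.sum_congr rfl fun i _ => ?_
      congr 1
      rw [← Finset.prod_sdiff (Finset.subset_univ U), mul_comm]
      congr 1
      refine Finset.prod_congr rfl fun v hv => ?_
      have h4 := hN v i
      have h5 : 0 ≤ y t v - τ i v := by
        simp only [y, hv, if_true]
        have := neg_abs_le (x v)
        have := le_abs_self (τ i v)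
        linarith
      rw [s1, if_pos h5]
    rw [h3]
    apply hn
    obtain ⟨v, hv, hxv⟩ := hx
    exact ⟨v, by simpa [y, hv] using hxv⟩
  have := congrArg (Polynomial.eval 0) key
  rwa [e1, Polynomial.eval_zero, y0] at this

lemma PiG_one (T : Finset V) (x : V → ℤ)
    (h : ∀ u v, x u ≠ 0 → x v ≠ 0 → cpt G T u = cpt G T v) : PiG G T x = 1 + ∑ v, x v := by
  unfold PiG
  by_cases h0 : ∃ u, x u ≠ 0
  · obtain ⟨u, hu⟩ := h0
    rw [Finset.prod_eq_single (cpt G T u)]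
    · congr 1
      rw [Finset.sum_filter]
      refine Finset.sum_congr rfl fun v _ => ?_
      by_cases hv : x v = 0
      · simp [hv]
      · rw [if_pos (h v u hv hu)]
    · intro r _ hr
      rw [Finset.sum_eq_zero, add_zero]
      intro v hv
      by_contra h1
      simp at hv
      exact hr (by rw [← hv]; exact h v u h1 hu)
    · simp
  · push Not at h0
    simp [h0]


lemma gS_full (hh : ∀ x : V → ℤ, (∀ v, 0 ≤ x v) → hS ε τ x = PiG G (Finset.univ.filter fun v => 0 < x v) x)
    (hn : ∀ x : V → ℤ, (∃ v, x v < 0) → hS ε τ x = 0) (hG : G.Connected)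
    (c : V → ℤ) (hc : ∀ v, 1 ≤ c v) : gS ε τ c = (-1) ^ Fintype.card V * (1 - ∑ v, c v) := by
  rw [gS_eq, Finset.sum_eq_single Finset.univ]
  · rw [HU_eq G ε τ hh Finset.univ (-c) (by simp), PiG_one]
    · simp [sub_eq_add_neg]
    · intro u v _ _
      rw [cpt_eq]
      have : GT G (Finset.univ ∪ Finset.univ.filter fun v => 0 < (-c) v) = G := by
        ext a b; simp [GT]
      rw [this]
      exact hG.preconnected u v
  · intro U _ hU
    rw [HU_zero ε τ hn U, mul_zero]
    obtain ⟨v, hv⟩ : ∃ v, v ∉ U := by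
      by_contra h
      push Not at h
      exact hU (Finset.eq_univ_iff_forall.2 h)
    refine ⟨v, hv, ?_⟩
    have := hc v
    simp; omega
  · simp

lemma gS_cancel (c : V → ℤ) (v : V) (h : ∀ U, v ∉ U → HU ε τ U (-c) = HU ε τ (insert v U) (-c)) :
    gS ε τ c = 0 := by
  rw [gS_eq]
  have e : (Finset.univ : Finset V) = insert v (Finset.univ.erase v) := by simp
  rw [e, Finset.sum_powerset_insert (by simp), ← Finset.sum_add_distrib]
  refine Finset.sum_eq_zero fun U hU => ?_
  have hv : v ∉ U := fun hv => by
    have := Finset.mem_powerset.1 hU hv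
    simp at this
  rw [← h U hv, Finset.card_insert_of_notMem hv]
  ring

lemma gS_neg (hh : ∀ x : V → ℤ, (∀ v, 0 ≤ x v) → hS ε τ x = PiG G (Finset.univ.filter fun v => 0 < x v) x)
    (hn : ∀ x : V → ℤ, (∃ v, x v < 0) → hS ε τ x = 0) (c : V → ℤ) (v : V) (hv : c v < 0) :
    gS ε τ c = 0 := by
  refine gS_cancel ε τ c v fun U hU => ?_
  by_cases hx : ∀ u, u ∉ U → 0 ≤ (-c) u
  · rw [HU_eq G ε τ hh U _ hx, HU_eq G ε τ hh (insert v U) _ (fun u hu => hx u (by simp at hu; tauto))]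
    congr 1
    ext u
    simp only [Finset.mem_union, Finset.mem_insert, Finset.mem_filter, Finset.mem_univ, true_and]
    constructor
    · tauto
    · rintro ((rfl | h) | h)
      · right; simpa using hv
      · exact Or.inl h
      · exact Or.inr h
  · push Not at hx
    obtain ⟨u, hu, hu'⟩ := hx
    rw [HU_zero ε τ hn U _ ⟨u, hu, hu'⟩, HU_zero ε τ hn (insert v U) _ ⟨u, ?_, hu'⟩]
    simp only [Finset.mem_insert, not_or]
    refine ⟨?_, hu⟩
    rintro rfl
    simp at hu'; omega

lemma gS_conn (hh : ∀ x : V → ℤ, (∀ v, 0 ≤ x v) → hS ε τ x = PiG G (Finset.univ.filter fun v => 0 < x v) x)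
    (hn : ∀ x : V → ℤ, (∃ v, x v < 0) → hS ε τ x = 0) (c : V → ℤ) (hc : ∀ v, 0 ≤ c v) (W : Finset V)
    (hW : ∀ v, v ∈ W ↔ 0 < c v) (hconn : ∀ u ∈ W, ∀ v ∈ W, (GT G W).Reachable u v)
    (v : V) (hv : v ∉ W) : gS ε τ c = 0 := by
  have main : ∀ U, W ⊆ U → HU ε τ U (-c) = 1 + ∑ v, (-c) v := by
    intro U hU
    rw [HU_eq G ε τ hh U]
    · apply PiG_one
      intro a b ha hb
      rw [cpt_eq]
      have h1 : ∀ a, (-c) a ≠ 0 → a ∈ W := fun a ha => by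
        rw [hW]; have := hc a; simp at ha; omega
      refine (hconn a (h1 a ha) b (h1 b hb)).mono ?_
      intro x y hxy
      exact ⟨hxy.1, Finset.mem_union_left _ (hU hxy.2.1), Finset.mem_union_left _ (hU hxy.2.2)⟩
    · intro u hu
      have h1 : u ∉ W := fun h => hu (hU h)
      rw [hW] at h1
      simp; omega
  have main0 : ∀ U, ¬ W ⊆ U → HU ε τ U (-c) = 0 := by
    intro U hU
    obtain ⟨u, hu, hu'⟩ := Finset.not_subset.1 hU
    apply HU_zero ε τ hn
    refine ⟨u, hu', ?_⟩
    rw [hW] at hu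
    simpa using hu
  refine gS_cancel ε τ c v fun U hU => ?_
  by_cases h : W ⊆ U
  · rw [main U h, main _ (h.trans (Finset.subset_insert _ _))]
  · rw [main0 U h, main0]
    rwa [Finset.subset_insert_iff_of_notMem hv]

end Numeric
end

noncomputable section

section Endgame
open Module

lemma path_of_cover {n : ℕ} (G : SimpleGraph (Fin n)) {p q : Fin n} (w : G.Walk p q)
    (hw : w.length = G.dist p q) (hcov : ∀ v, v ∈ w.support) :
    Nonempty (G ≃g SimpleGraph.pathGraph n) := by
  have hp : w.IsPath := w.isPath_of_length_eq_dist hw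
  have hlen : w.length + 1 = n := by
    have h1 := List.toFinset_card_of_nodup hp.support_nodup
    have h2 : w.support.toFinset = Finset.univ := by
      ext v; simp [hcov v]
    rw [h2, SimpleGraph.Walk.length_support] at h1
    simpa using h1.symm
  let φ : Fin n → Fin n := fun i => w.getVert i
  have hsurj : Function.Surjective φ := by
    intro v
    obtain ⟨i, hi, hle⟩ := SimpleGraph.Walk.mem_support_iff_exists_getVert.1 (hcov v)
    exact ⟨⟨i, by omega⟩, hi⟩
  have hinj : Function.Injective φ := Finite.injective_iff_surjective.2 hsurj
  have hlt : ∀ i j : Fin n, i.1 < j.1 → G.Adj (φ i) (φ j) → i.1 + 1 = j.1 := by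
    intro i j hij hadj
    have h1 : G.dist p q ≤ ((w.take i).append (SimpleGraph.Walk.cons hadj (w.drop j))).length :=
      SimpleGraph.dist_le _
    rw [SimpleGraph.Walk.length_append, SimpleGraph.Walk.length_cons, SimpleGraph.Walk.take_length,
      SimpleGraph.Walk.drop_length, ← hw] at h1
    have := j.2
    omega
  refine ⟨(RelIso.mk (Equiv.ofBijective φ ⟨hinj, hsurj⟩) ?_ : SimpleGraph.pathGraph n ≃g G).symm⟩
  intro i j
  rw [SimpleGraph.pathGraph_adj]
  change G.Adj (φ i) (φ j) ↔ _
  constructor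
  · intro h
    rcases lt_trichotomy i.1 j.1 with h1 | h1 | h1
    · exact Or.inl (hlt i j h1 h)
    · exact absurd h (by rw [Fin.ext h1]; exact G.irrefl)
    · exact Or.inr (hlt j i h1 h.symm)
  · rintro (h | h)
    · have := w.adj_getVert_succ (i := i) (by have := j.2; omega)
      simp only [φ]; rwa [h] at this
    · have := w.adj_getVert_succ (i := j) (by have := i.2; omega)
      simp only [φ]; rw [h] at this; exact this.symm

lemma walk_GT {V : Type} [Fintype V] [DecidableEq V] (G : SimpleGraph V) {p q : V} (w : G.Walk p q)
    (u : V) (hu : u ∈ w.support.toFinset) : (GT G w.support.toFinset).Reachable p u := by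
  have key : ∀ i, i ≤ w.length → (GT G w.support.toFinset).Reachable p (w.getVert i) := by
    intro i
    induction i with
    | zero => intro _; simp
    | succ i ih =>
      intro hi
      refine (ih (by omega)).trans (SimpleGraph.Adj.reachable ?_)
      refine ⟨w.adj_getVert_succ (by omega), ?_, ?_⟩ <;>
      simp [SimpleGraph.Walk.getVert_mem_support]
  rw [List.mem_toFinset] at hu
  obtain ⟨i, hi, hle⟩ := SimpleGraph.Walk.mem_support_iff_exists_getVert.1 hu
  rw [← hi]; exact key i hle

variable {V K : Type} [Fintype V] [DecidableEq V] [Field K]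

def om (I : Ideal (MvPolynomial (V ⊕ V) K)) (d : V → ℤ) : ℤ := sd K (wV V) d - jd (wV V) I d

lemma om_nonneg (I : Ideal (MvPolynomial (V ⊕ V) K)) (d : V → ℤ) : 0 ≤ om I d := by
  have : jd (wV V) I d ≤ sd K (wV V) d := by
    have := wV_fd (K := K) d
    unfold jd sd
    exact_mod_cast Submodule.finrank_mono inf_le_right
  unfold om; omega

lemma om_anti {I J : Ideal (MvPolynomial (V ⊕ V) K)} (h : J ≤ I) (d : V → ℤ) : om I d ≤ om J d := by
  have : jd (wV V) J d ≤ jd (wV V) I d := by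
    have := wV_fd (K := K) d
    unfold jd
    have hf : Module.Finite K ↥(I.restrictScalars K ⊓ weightedHomogeneousSubmodule K (wV V) d) :=
      Submodule.finiteDimensional_of_le inf_le_right
    have hle : (J.restrictScalars K ⊓ weightedHomogeneousSubmodule K (wV V) d) ≤
        (I.restrictScalars K ⊓ weightedHomogeneousSubmodule K (wV V) d) :=
      inf_le_inf_right _ (fun x hx => h hx)
    exact_mod_cast Submodule.finrank_mono hle
  unfold om; omega

lemma om_neg (I : Ideal (MvPolynomial (V ⊕ V) K)) (d : V → ℤ) (h : ∃ v, d v < 0) : om I d = 0 := by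
  have h1 : sd K (wV V) d = 0 := by
    rw [sd_eq]
    obtain ⟨v, hv⟩ := h
    exact Finset.prod_eq_zero (Finset.mem_univ v) (by simp [s1, hv])
  have h2 := om_nonneg I d
  have h3 : 0 ≤ jd (wV V) I d := by simp [jd]
  unfold om at *; omega

lemma om_mono (I : Ideal (MvPolynomial (V ⊕ V) K)) (d d' : V → ℤ) (h0 : ∀ v, 0 ≤ d v)
    (hdd : ∀ v, d v ≤ d' v) (h : om I d = 0) : om I d' = 0 := by
  have hfd := wV_fd (K := K) d
  have h1 : I.restrictScalars K ⊓ weightedHomogeneousSubmodule K (wV V) d =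
      weightedHomogeneousSubmodule K (wV V) d := by
    refine Submodule.eq_of_le_of_finrank_eq inf_le_right ?_
    unfold om sd jd at h
    omega
  have h2 : weightedHomogeneousSubmodule K (wV V) d' ≤ I.restrictScalars K := by
    rw [whs_spn, spn, Submodule.span_le]
    rintro _ ⟨m', hm', rfl⟩
    obtain ⟨c, rfl⟩ := nonneg_cast (c := d) (by push Not; exact h0)
    let m : V ⊕ V →₀ ℕ := Finsupp.equivFunOnFinite.symm (Sum.elim (fun v => min (m' (Sum.inl v)) (c v))
      (fun v => c v - min (m' (Sum.inl v)) (c v)))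
    have hm : Finsupp.weight (wV V) m = fun v => (c v : ℤ) := by
      funext v
      rw [weight_wV]
      simp [m]
    have hle : m ≤ m' := by
      have h3 := fun v => congrFun hm' v
      simp only [weight_wV] at h3
      intro i
      rcases i with v | v
      · simp [m]
      · have := h3 v
        have h6 : (c v : ℤ) ≤ d' v := hdd v
        simp [m]
        omega
    have h4 : (monomial m 1 : MvPolynomial (V ⊕ V) K) ∈ I := by
      have : (monomial m 1 : MvPolynomial (V ⊕ V) K) ∈ weightedHomogeneousSubmodule K (wV V) (fun v => (c v : ℤ)) :=
        isWeightedHomogeneous_monomial _ _ _ hm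
      rw [← h1] at this
      exact this.1
    have h5 : (monomial m' 1 : MvPolynomial (V ⊕ V) K) = monomial (m' - m) 1 * monomial m 1 := by
      rw [monomial_mul, tsub_add_cancel_of_le hle, mul_one]
    simp only [SetLike.mem_coe, Submodule.restrictScalars_mem]
    rw [h5]
    exact Ideal.mul_mem_left _ _ h4
  unfold om sd jd
  rw [inf_eq_right.2 h2]; ring

theorem endgame {n : ℕ} (hn2 : 2 ≤ n) (G : SimpleGraph (Fin n)) (hG : G.Connected)
    {E : Type} [Fintype E] (ε : E → ℤ) (τ : E → Fin n → ℤ) (I : Ideal (MvPolynomial (Fin n ⊕ Fin n) K))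
    (hJI : binomialEdgeIdeal K G ≤ I) (b : Fin n → ℤ) (δ : ℤ) (hδ : δ * δ = 1)
    (hA : ∀ x, om (binomialEdgeIdeal K G) x = hS ε τ x)
    (hB : ∀ c, om I (c - b) = δ * gS ε τ c) : Nonempty (G ≃g SimpleGraph.pathGraph n) := by
  have hh : ∀ x : Fin n → ℤ, (∀ v, 0 ≤ x v) → hS ε τ x = PiG G (Finset.univ.filter fun v => 0 < x v) x := by
    intro x hx
    rw [← hA, ← hil (K := K) G x hx]; rfl
  have hn : ∀ x : Fin n → ℤ, (∃ v, x v < 0) → hS ε τ x = 0 := by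
    intro x hx
    rw [← hA]; exact om_neg _ x hx
  have hδ' : δ = 1 ∨ δ = -1 := by
    rcases Int.isUnit_iff.1 (IsUnit.of_mul_eq_one δ hδ) with h | h <;> simp [h]
  have hfull : ∀ c : Fin n → ℤ, (∀ v, 1 ≤ c v) → om I (c - b) = ∑ v, c v - 1 := by
    intro c hc
    have h1 := gS_full G ε τ hh hn hG c hc
    have h2 := hB c
    have h3 := om_nonneg I (c - b)
    have h4 : (n : ℤ) ≤ ∑ v, c v := by
      have : ∑ v : Fin n, (1 : ℤ) ≤ ∑ v, c v := Finset.sum_le_sum fun v _ => hc v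
      simpa using this
    rw [h1] at h2
    rcases hδ' with rfl | rfl <;> rcases neg_one_pow_eq_or ℤ (Fintype.card (Fin n)) with e | e <;>
      rw [e] at h2 <;> push_cast at * <;> omega
  have h1 : om I (1 - b) ≠ 0 := by
    rw [hfull 1 (by simp)]
    simp; omega
  have hb1 : ∀ v, b v ≤ 1 := by
    intro v
    by_contra h
    exact h1 (om_neg I _ ⟨v, by simp; omega⟩)
  have hmono : ∀ c : Fin n → ℤ, (∀ v, b v ≤ c v) → (∀ v, c v ≤ 1) → gS ε τ c ≠ 0 := by
    intro c hc hc1 h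
    refine h1 (om_mono I (c - b) (1 - b) (fun v => by simpa using hc v)
      (fun v => by simpa using hc1 v) ?_)
    rw [hB, h, mul_zero]
  have hb0 : ∀ v, 0 ≤ b v := by
    intro v
    by_contra h
    exact hmono b (fun _ => le_rfl) hb1 (gS_neg G ε τ hh hn b v (by omega))
  have hconn : ∀ W : Finset (Fin n), (∀ v, 0 < b v → v ∈ W) →
      (∀ u ∈ W, ∀ v ∈ W, (GT G W).Reachable u v) → ∀ v, v ∈ W := by
    intro W hW hr v
    by_contra hv
    refine hmono (fun v => if v ∈ W then 1 else 0) ?_ ?_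
      (gS_conn G ε τ hh hn _ ?_ W ?_ hr v hv)
    · intro v
      by_cases h : v ∈ W
      · simpa [h] using hb1 v
      · have := hW v
        simp [h]
        by_contra h'
        exact h (this (by omega))
    · intro v; split_ifs <;> omega
    · intro v; split_ifs <;> omega
    · intro v; split_ifs with h <;> simp [h]
  set B := Finset.univ.filter fun v => 0 < b v with hB'
  have hsumb : ∑ v, b v = B.card := by
    have : ∀ v, b v = if 0 < b v then 1 else 0 := by
      intro v
      have := hb0 v; have := hb1 v
      split_ifs <;> omega
    rw [Finset.sum_congr rfl fun v _ => this v]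
    simp [hB']
  have hcard : B.card ≤ 2 := by
    have h2 := hfull (1 + b) (fun v => by have := hb0 v; simp; omega)
    have h3 := om_anti hJI (1 + b - b)
    rw [h2, hA, hh _ (by simp), PiG_one] at h3
    · simp [Finset.sum_add_distrib, hsumb] at h3
      omega
    · intro u v _ _
      rw [cpt_eq]
      have : GT G (Finset.univ.filter fun v => 0 < ((1 : Fin n → ℤ) + b - b) v) = G := by
        ext a b; simp [GT]
      rw [this]
      exact hG.preconnected u v
  have hcov : ∀ p q, (∀ v ∈ B, v = p ∨ v = q) → Nonempty (G ≃g SimpleGraph.pathGraph n) := by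
    intro p q hpq
    obtain ⟨w, hw⟩ := hG.exists_walk_length_eq_dist p q
    refine path_of_cover G w hw ?_
    have := hconn w.support.toFinset (by
      intro v hv
      rcases hpq v (by simp [hB', hv]) with rfl | rfl <;> simp) (by
      intro u hu v hv
      exact (walk_GT G w u hu).symm.trans (walk_GT G w v hv))
    simpa using this
  have : Nonempty (Fin n) := ⟨⟨0, by omega⟩⟩
  rcases Nat.lt_or_ge B.card 2 with h2 | h2
  · have : ∃ u, ∀ v ∈ B, v = u := by
      rcases B.eq_empty_or_nonempty with h | ⟨u, hu⟩
      · exact ⟨Classical.arbitrary _, by simp [h]⟩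
      · exact ⟨u, fun v hv => Finset.card_le_one.1 (by omega) v hv u hu⟩
    obtain ⟨u, hu⟩ := this
    exact hcov u u (fun v hv => Or.inl (hu v hv))
  · obtain ⟨p, q, _, hpq⟩ := Finset.card_eq_two.1 (le_antisymm hcard h2)
    exact hcov p q (fun v hv => by rw [hpq] at hv; simpa using hv)

end Endgame
end

noncomputable section

lemma br_ne {V K : Type} [Fintype V] [DecidableEq V] [Field K] {u v : V} (h : u ≠ v) : br K u v ≠ 0 := by
  intro h0
  have := congrArg (MvPolynomial.eval (Sum.elim (fun a => if a = u then (1:K) else 0)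
    (fun a => if a = v then (1:K) else 0))) h0
  simp [br, h, h.symm] at this

theorem main_aux {K : Type} [Field K] {n : ℕ} (hn2 : 2 ≤ n) (G : SimpleGraph (Fin n)) (hconn : G.Connected)
    (hGor : QuotientIsGorenstein (binomialEdgeIdeal K G)) : Nonempty (G ≃g SimpleGraph.pathGraph n) := by
  let φ : (Fin n → ℤ) →+ ℤ :=
    { toFun := fun x => ∑ v, x v
      map_zero' := by simp
      map_add' := fun x y => by simp [Finset.sum_add_distrib] }
  have hφ : ∀ i, φ (wV (Fin n) i) = 1 := by
    rintro (i | i) <;> simp [φ, wV]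
  obtain ⟨F, p, h1, h2, h3, h4⟩ := gor_res (w := wV (Fin n)) (J := binomialEdgeIdeal K G) wV_pos
    (fun f hf => J_graded G f hf) (fun f hf => J_const G f hf) φ hφ hGor
  have hp : p ≠ 0 := by
    rintro rfl
    have : Nontrivial (Fin n) := Fin.nontrivial_iff_two_le.2 hn2
    obtain ⟨u⟩ := hconn.nonempty
    obtain ⟨v, huv⟩ := hconn.preconnected.exists_adj_of_nontrivial u
    have hb : br K u v ∈ binomialEdgeIdeal K G := br_mem G huv
    have hr0 := F.rank0
    have e0 : Fin (F.rank 0) := ⟨0, by omega⟩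
    obtain ⟨y, hy⟩ := (F.exact0 (Pi.single e0 (br K u v))).1 (by simpa using hb)
    have h5 := congrFun hy e0
    have hr1 := h2 1 (by omega)
    have : IsEmpty (Fin (F.rank (0+1))) := by rw [zero_add, hr1]; infer_instance
    rw [Pi.single_eq_same] at h5
    exact br_ne huv.ne (h5.trans (by simp [Matrix.mulVec, dotProduct]))
  obtain ⟨q, rfl⟩ : ∃ q, p = q + 1 := ⟨p - 1, by omega⟩
  obtain ⟨I, b, hJI, hI⟩ := euler2 (wV (Fin n)) (fun c => wV_fd c) F q h2 h1 (h3 (by omega)) h4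
  have hE := euler1 (wV (Fin n)) (fun c => wV_fd c) F (q+1) h2
  let E := Σ k : Fin (q+2), Fin (F.rank k)
  refine endgame (E := E) hn2 G hconn (fun e => (-1)^(e.1 : ℕ)) (fun e => F.tw e.1 e.2) I hJI
    (fun v => 2 - b v) ((-1)^(q+1)) (by rw [← mul_pow]; simp) ?_ ?_
  · intro x
    rw [om, hE, hS, Finset.sum_range, Fintype.sum_sigma]
    refine Finset.sum_congr rfl fun k _ => ?_
    rw [Finset.mul_sum]
    refine Finset.sum_congr rfl fun e _ => ?_
    rw [sd_eq]; rfl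
  · intro c
    have h5 := hI (fun v => c v - 2)
    have h6 : (c - fun v => 2 - b v) = (fun v => c v - 2) + b := by
      funext v; simp; ring
    rw [om, h6, h5, gS, Finset.sum_range, Fintype.sum_sigma]
    congr 1
    refine Finset.sum_congr rfl fun k _ => ?_
    rw [Finset.mul_sum]
    refine Finset.sum_congr rfl fun e _ => ?_
    rw [sd_eq]; rfl

end

/-- **Gorenstein binomial edge ideals.**  If `G` is a connected graph on `[n]`
such that `S/J_G` is Gorenstein, then `G` is a path graph. -/
theorem gorenstein_binomialEdgeIdeal_implies_path
    (K : Type) [Field K] (n : ℕ) (G : SimpleGraph (Fin n))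
    (hconn : G.Connected)
    (hGor : QuotientIsGorenstein (binomialEdgeIdeal K G)) :
    Nonempty (G ≃g SimpleGraph.pathGraph n) := by
  by_cases hn2 : 2 ≤ n
  · exact main_aux hn2 G hconn hGor
  · have : Subsingleton (Fin n) := Fin.subsingleton_iff_le_one.2 (by omega)
    have : G = SimpleGraph.pathGraph n := by
      ext a b
      rw [Subsingleton.elim a b]
      simp
    exact ⟨this ▸ SimpleGraph.Iso.refl⟩

end
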